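/- There exists an absolute constant γ₀ > 0 such that for every γ > γ₀ there is no unidirectional Stokes wave solution (ψ, η, r) with Bernoulli constant r = R(0) = γ + √(2/γ). -/

import Mathlib

noncomputable section

open Real Set

/-- Partial derivative of `ψ` in the horizontal variable. -/
def px (ψ : ℝ → ℝ → ℝ) (x y : ℝ) : ℝ := deriv (fun t => ψ t y) x

/-- Partial derivative of `ψ` in the vertical variable. -/
def py (ψ : ℝ → ℝ → ℝ) (x y : ℝ) : ℝ := deriv (fun t => ψ x t) y

/-- Second partial derivative in `x`. -/
def pxx (ψ : ℝ → ℝ → ℝ) (x y : ℝ) : ℝ := deriv (fun t => px ψ t y) x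

/-- Second partial derivative in `y`. -/
def pyy (ψ : ℝ → ℝ → ℝ) (x y : ℝ) : ℝ := deriv (fun t => py ψ x t) y

/-- Depth `d(s)` of the laminar (stream) flow with surface value `s` of `ψ_y`. -/
def lamDepth (γ s : ℝ) : ℝ := (-s + Real.sqrt (s ^ 2 + 2 * γ)) / γ

/-- Bernoulli constant `R(s) = ½ s² + γ + d(s)` of the laminar flow. -/
def bernR (γ s : ℝ) : ℝ := s ^ 2 / 2 + γ + lamDepth γ s

/-- `s` is the (unique) positive critical point `s_c` of `R`, characterized by the
equation `s - 1/γ + s/(γ √(s² + 2γ)) = 0`. -/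
def IsCrit (γ s : ℝ) : Prop :=
  0 < s ∧ s - 1 / γ + s / (γ * Real.sqrt (s ^ 2 + 2 * γ)) = 0

/-- A solution `(ψ, η, r)` of the stream-function formulation with constant adverse
vorticity `ω = -γ`:  `Δψ = γ` in the fluid domain `D_η`, the Bernoulli condition on the
surface, `ψ = 1` on the surface and `ψ = 0` on the flat bottom. -/
structure StreamSolution (γ : ℝ) (ψ : ℝ → ℝ → ℝ) (η : ℝ → ℝ) (r : ℝ) : Prop where
  eta_smooth : ContDiff ℝ (⊤ : ℕ∞) η
  eta_pos : ∀ x, 0 < η x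
  psi_smooth : ContDiff ℝ (⊤ : ℕ∞) (fun p : ℝ × ℝ => ψ p.1 p.2)
  laplace : ∀ x y, 0 < y → y < η x → pxx ψ x y + pyy ψ x y = γ
  bernoulli : ∀ x, (px ψ x (η x)) ^ 2 / 2 + (py ψ x (η x)) ^ 2 / 2 + η x = r
  surface_val : ∀ x, ψ x (η x) = 1
  bottom_val : ∀ x, ψ x 0 = 0

/-- The flow is unidirectional: `ψ_y > 0` everywhere in the fluid domain `D_η`. -/
def Unidirectional (ψ : ℝ → ℝ → ℝ) (η : ℝ → ℝ) : Prop :=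
  ∀ x y, 0 < y → y < η x → 0 < py ψ x y

/-- A Stokes wave with half-period `Λ`: the solution is `2Λ`-periodic and even in `x`,
and the surface profile is strictly decreasing from the crest (`x = 0`) to the
trough (`x = Λ`).  Thus `η̂ = max η = η 0` and `η̌ = min η = η Λ`. -/
structure StokesWave (γ : ℝ) (ψ : ℝ → ℝ → ℝ) (η : ℝ → ℝ) (r Λ : ℝ) : Prop where
  sol : StreamSolution γ ψ η r
  lam_pos : 0 < Λ
  eta_periodic : ∀ x, η (x + 2 * Λ) = η x
  eta_even : ∀ x, η (-x) = η x
  psi_periodic : ∀ x y, ψ (x + 2 * Λ) y = ψ x y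
  psi_even : ∀ x y, ψ (-x) y = ψ x y
  eta_anti : StrictAntiOn η (Set.Icc 0 Λ)

/-- A solitary wave (relative to the critical value `sc = s_c` of `γ`): the solution is
even in `x`, the profile is strictly decreasing on `(0, ∞)` and non-constant, and the
flow converges to a supercritical laminar flow `(U(·; s), d(s))` with `s > s_c`,
`R(s) = r` as `|x| → ∞`.  The crest is at `x = 0`, `η̂ = η 0` and `η̌ = inf η = d(s)`. -/
structure SolitaryWave (γ sc : ℝ) (ψ : ℝ → ℝ → ℝ) (η : ℝ → ℝ) (r : ℝ) : Prop where
  sol : StreamSolution γ ψ η r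
  eta_even : ∀ x, η (-x) = η x
  psi_even : ∀ x y, ψ (-x) y = ψ x y
  eta_anti : StrictAntiOn η (Set.Ioi 0)
  nonconst : ∃ x₁ x₂, η x₁ ≠ η x₂
  asymptotic : ∃ s, sc < s ∧ bernR γ s = r ∧
    ∀ ε > 0, ∃ X : ℝ, ∀ x : ℝ, X ≤ |x| →
      |η x - lamDepth γ s| ≤ ε ∧
      ∀ y ∈ Set.Icc 0 (η x), |px ψ x y| + |py ψ x y - (γ * y + s)| ≤ ε


/-! ### Complex analysis: a Harnack inequality for functions with nonnegative real part -/

lemma carath_pos {p : ℂ → ℂ} {ρ c : ℝ} (hc : 0 < c)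
    (hp : DifferentiableOn ℂ p (Metric.ball 0 ρ)) (hre : ∀ z ∈ Metric.ball (0 : ℂ) ρ, 0 ≤ (p z).re)
    (h0 : p 0 = c) {z : ℂ} (hz : z ∈ Metric.ball (0 : ℂ) ρ) :
    ‖p z‖ * (ρ - ‖z‖) ≤ c * (ρ + ‖z‖) ∧ c * (ρ - ‖z‖) ≤ (p z).re * (ρ + ‖z‖) := by
  have hz' : ‖z‖ < ρ := by simpa using hz
  have hρ : 0 < ρ := lt_of_le_of_lt (norm_nonneg z) hz'
  have hne : ∀ w ∈ Metric.ball (0 : ℂ) ρ, p w + c ≠ 0 := by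
    intro w hw h
    have h1 := congrArg Complex.re h
    simp at h1
    linarith [hre w hw]
  set Q : ℂ → ℂ := fun w => (p w - c) / (p w + c) with hQ
  have hQ0 : Q 0 = 0 := by simp [hQ, h0]
  have hQd : DifferentiableOn ℂ Q (Metric.ball 0 ρ) :=
    (hp.sub_const _).div (hp.add_const _) hne
  have hmaps : MapsTo Q (Metric.ball 0 ρ) (Metric.closedBall (Q 0) 1) := by
    intro w hw
    rw [hQ0, mem_closedBall_zero_iff]
    simp only [hQ, norm_div]
    rw [div_le_one (norm_pos_iff.2 (hne w hw))]
    rw [← sq_le_sq₀ (norm_nonneg _) (norm_nonneg _), ← Complex.normSq_eq_norm_sq,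
      ← Complex.normSq_eq_norm_sq, Complex.normSq_apply, Complex.normSq_apply]
    simp
    nlinarith [hre w hw]
  have hS := Complex.dist_le_div_mul_dist_of_mapsTo_ball hQd hmaps hz
  rw [hQ0, dist_zero_right, dist_zero_right] at hS
  simp only [hQ, norm_div] at hS
  have hpos := norm_pos_iff.2 (hne z hz)
  have hS2 : ‖p z - c‖ * ρ ≤ ‖z‖ * ‖p z + c‖ := by
    rw [div_le_iff₀ hpos] at hS
    have : 1 / ρ * ‖z‖ * ‖p z + c‖ * ρ = ‖z‖ * ‖p z + c‖ := by field_simp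
    nlinarith
  have hcn : ‖(c : ℂ)‖ = c := by simp [abs_of_pos hc]
  constructor
  · have h1 := norm_sub_norm_le (p z) c
    have h2 := norm_add_le (p z) c
    rw [hcn] at h1 h2
    nlinarith [norm_nonneg z]
  · have hsq : (‖p z - c‖ * ρ) ^ 2 ≤ (‖z‖ * ‖p z + c‖) ^ 2 :=
      pow_le_pow_left₀ (by positivity) hS2 2
    rw [mul_pow, mul_pow, ← Complex.normSq_eq_norm_sq, ← Complex.normSq_eq_norm_sq (p z + c),
      Complex.normSq_apply, Complex.normSq_apply] at hsq
    simp at hsq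
    have hu := hre z hz
    set u := (p z).re
    set v := (p z).im
    set s := ‖z‖
    have hs : 0 ≤ s := norm_nonneg z
    have h3 : (ρ * (c - u)) ^ 2 ≤ (s * (u + c)) ^ 2 := by
      have : s ^ 2 * (v * v) ≤ ρ ^ 2 * (v * v) :=
        mul_le_mul_of_nonneg_right (pow_le_pow_left₀ hs hz'.le 2) (mul_self_nonneg v)
      nlinarith
    have h4 := abs_le_of_sq_le_sq' h3 (by positivity)
    nlinarith [h4.2]

lemma carath_nonneg {p : ℂ → ℂ} {ρ c : ℝ} (hc : 0 ≤ c)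
    (hp : DifferentiableOn ℂ p (Metric.ball 0 ρ)) (hre : ∀ z ∈ Metric.ball (0 : ℂ) ρ, 0 ≤ (p z).re)
    (h0 : p 0 = c) {z : ℂ} (hz : z ∈ Metric.ball (0 : ℂ) ρ) :
    ‖p z‖ * (ρ - ‖z‖) ≤ c * (ρ + ‖z‖) ∧ c * (ρ - ‖z‖) ≤ (p z).re * (ρ + ‖z‖) := by
  rcases hc.eq_or_lt with rfl | hc
  swap
  · exact carath_pos hc hp hre h0 hz
  have hz' : ‖z‖ < ρ := by simpa using hz
  have hρ : 0 < ρ := lt_of_le_of_lt (norm_nonneg z) hz'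
  refine ⟨?_, by simpa using mul_nonneg (hre z hz) (by positivity)⟩
  have key : ∀ δ > 0, ‖p z‖ * (ρ - ‖z‖) ≤ 0 + δ := by
    intro δ hδ
    set d := δ / (2 * ρ) with hd
    have hd0 : 0 < d := by positivity
    have h1 := (carath_pos (p := fun w => p w + d) (ρ := ρ) hd0 (hp.add_const _)
      (by intro w hw; simp; linarith [hre w hw]) (by simp [h0]) hz).1
    have h2 : ‖p z‖ ≤ ‖p z + d‖ + d := by
      have := norm_sub_le (p z + d) d
      simpa [abs_of_pos hd0] using this
    have h3 : d * (2 * ρ) = δ := by rw [hd]; field_simp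
    have hn := norm_nonneg z
    nlinarith
  simpa using le_of_forall_pos_le_add key

/-! ### Calculus of smooth functions of two variables -/

/-- Smooth function of two real variables. -/
def Sm (f : ℝ → ℝ → ℝ) : Prop := ContDiff ℝ (⊤ : ℕ∞) (fun p : ℝ × ℝ => f p.1 p.2)

namespace Sm

variable {f g : ℝ → ℝ → ℝ}

lemma diff (hf : Sm f) : Differentiable ℝ (fun p : ℝ × ℝ => f p.1 p.2) :=
  ContDiff.differentiable hf (by simp)

lemma cont (hf : Sm f) : Continuous (fun p : ℝ × ℝ => f p.1 p.2) := ContDiff.continuous hf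

lemma px_eq (hf : Sm f) (x y : ℝ) :
    px f x y = fderiv ℝ (fun p : ℝ × ℝ => f p.1 p.2) (x, y) (1, 0) := by
  have h1 := (hf.diff (x, y)).hasFDerivAt
  have h2 : HasDerivAt (fun t : ℝ => (t, y)) ((1 : ℝ), (0 : ℝ)) x :=
    (hasDerivAt_id x).prodMk (hasDerivAt_const x y)
  exact (h1.comp_hasDerivAt x h2).deriv

lemma py_eq (hf : Sm f) (x y : ℝ) :
    py f x y = fderiv ℝ (fun p : ℝ × ℝ => f p.1 p.2) (x, y) (0, 1) := by
  have h1 := (hf.diff (x, y)).hasFDerivAt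
  have h2 : HasDerivAt (fun t : ℝ => (x, t)) ((0 : ℝ), (1 : ℝ)) y :=
    (hasDerivAt_const y x).prodMk (hasDerivAt_id y)
  exact (h1.comp_hasDerivAt y h2).deriv

lemma sm_px (hf : Sm f) : Sm (px f) := by
  have h : (fun p : ℝ × ℝ => px f p.1 p.2) =
      fun p => fderiv ℝ (fun p : ℝ × ℝ => f p.1 p.2) p (1, 0) := by
    ext p; exact hf.px_eq p.1 p.2
  unfold Sm
  rw [h]
  exact (ContDiff.fderiv_right hf (by simp)).clm_apply contDiff_const

lemma sm_py (hf : Sm f) : Sm (py f) := by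
  have h : (fun p : ℝ × ℝ => py f p.1 p.2) =
      fun p => fderiv ℝ (fun p : ℝ × ℝ => f p.1 p.2) p (0, 1) := by
    ext p; exact hf.py_eq p.1 p.2
  unfold Sm
  rw [h]
  exact (ContDiff.fderiv_right hf (by simp)).clm_apply contDiff_const

/-- Chain rule along a curve. -/
lemma chain (hf : Sm f) {a b : ℝ → ℝ} {a' b' t : ℝ} (ha : HasDerivAt a a' t)
    (hb : HasDerivAt b b' t) :
    HasDerivAt (fun s => f (a s) (b s)) (px f (a t) (b t) * a' + py f (a t) (b t) * b') t := by
  have h1 := (hf.diff (a t, b t)).hasFDerivAt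
  have h2 := h1.comp_hasDerivAt t (ha.prodMk hb)
  have e : ((a', b') : ℝ × ℝ) = a' • ((1 : ℝ), (0 : ℝ)) + b' • ((0 : ℝ), (1 : ℝ)) := by simp
  rw [e, map_add, map_smul, map_smul, ← hf.px_eq, ← hf.py_eq] at h2
  simp only [smul_eq_mul] at h2
  rw [mul_comm a', mul_comm b'] at h2
  exact h2

lemma dx (hf : Sm f) (x y : ℝ) : HasDerivAt (fun t => f t y) (px f x y) x := by
  simpa using hf.chain (hasDerivAt_id x) (hasDerivAt_const x y)

lemma dy (hf : Sm f) (x y : ℝ) : HasDerivAt (fun t => f x t) (py f x y) y := by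
  simpa using hf.chain (hasDerivAt_const y x) (hasDerivAt_id y)

lemma comm (hf : Sm f) (x y : ℝ) : px (py f) x y = py (px f) x y := by
  have hs : IsSymmSndFDerivAt ℝ (fun p : ℝ × ℝ => f p.1 p.2) (x, y) :=
    (ContDiff.contDiffAt hf).isSymmSndFDerivAt (by simp; exact WithTop.coe_le_coe.2 (le_top : (2 : ℕ∞) ≤ ⊤))
  have hd : DifferentiableAt ℝ (fderiv ℝ (fun p : ℝ × ℝ => f p.1 p.2)) (x, y) :=
    (ContDiff.fderiv_right (m := (⊤ : ℕ∞)) hf (by simp)).differentiable (by simp) _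
  rw [hf.sm_py.px_eq, hf.sm_px.py_eq]
  have h1 : (fun p : ℝ × ℝ => px f p.1 p.2) =
      fun p => fderiv ℝ (fun p : ℝ × ℝ => f p.1 p.2) p (1, 0) := by
    ext p; exact hf.px_eq p.1 p.2
  have h2 : (fun p : ℝ × ℝ => py f p.1 p.2) =
      fun p => fderiv ℝ (fun p : ℝ × ℝ => f p.1 p.2) p (0, 1) := by
    ext p; exact hf.py_eq p.1 p.2
  rw [h1, h2, fderiv_clm_apply hd (by fun_prop), fderiv_clm_apply hd (by fun_prop)]
  simp
  exact hs (1, 0) (0, 1)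

end Sm


/-! ### Boundary Harnack inequality on a half disc -/

lemma eq_on_Icc_of_Ioo {g : ℝ → ℝ} (hg : Continuous g) {a b c : ℝ} (hab : a < b)
    (h : ∀ y, a < y → y < b → g y = c) {y : ℝ} (h1 : a ≤ y) (h2 : y ≤ b) : g y = c := by
  have hcl : IsClosed {y | g y = c} := isClosed_eq hg continuous_const
  have hsub : Ioo a b ⊆ {y | g y = c} := fun y hy => h y hy.1 hy.2
  have := closure_minimal hsub hcl
  rw [closure_Ioo hab.ne] at this
  exact this ⟨h1, h2⟩

lemma le_on_Icc_of_Ioo {g : ℝ → ℝ} (hg : Continuous g) {a b c : ℝ} (hab : a < b)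
    (h : ∀ y, a < y → y < b → c ≤ g y) {y : ℝ} (h1 : a ≤ y) (h2 : y ≤ b) : c ≤ g y := by
  have hcl : IsClosed {y | c ≤ g y} := isClosed_le continuous_const hg
  have hsub : Ioo a b ⊆ {y | c ≤ g y} := fun y hy => h y hy.1 hy.2
  have := closure_minimal hsub hcl
  rw [closure_Ioo hab.ne] at this
  exact this ⟨h1, h2⟩

lemma Sm.fderivC {g : ℝ → ℝ → ℝ} (hg : Sm g) (X0 : ℝ) (z : ℂ) :
    HasFDerivAt (fun w : ℂ => g (X0 + w.re) w.im)
      (px g (X0 + z.re) z.im • Complex.reCLM + py g (X0 + z.re) z.im • Complex.imCLM) z := by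
  have h1 := (hg.diff (X0 + z.re, z.im)).hasFDerivAt
  have h2 : HasFDerivAt (fun w : ℂ => (X0 + w.re, w.im))
      (Complex.reCLM.prod Complex.imCLM) z :=
    (Complex.reCLM.hasFDerivAt.const_add X0).prodMk Complex.imCLM.hasFDerivAt
  have h3 := h1.comp z h2
  refine h3.congr_fderiv ?_
  ext v
  have e : ((v.re, v.im) : ℝ × ℝ) = v.re • ((1 : ℝ), (0 : ℝ)) + v.im • ((0 : ℝ), (1 : ℝ)) := by
    simp
  simp only [ContinuousLinearMap.comp_apply, ContinuousLinearMap.prod_apply,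
    Complex.reCLM_apply, Complex.imCLM_apply]
  rw [e, map_add, map_smul, map_smul, ← hg.px_eq, ← hg.py_eq]
  simp [mul_comm]

/-- The complex gradient `φ_y + i φ_x`. -/
def cgrad (φ : ℝ → ℝ → ℝ) (X0 : ℝ) (z : ℂ) : ℂ :=
  (py φ (X0 + z.re) z.im : ℂ) + (px φ (X0 + z.re) z.im : ℂ) * Complex.I

/-- The derivative of the complex gradient. -/
def cgrad' (φ : ℝ → ℝ → ℝ) (X0 : ℝ) (z : ℂ) : ℂ :=
  (py (px φ) (X0 + z.re) z.im : ℂ) + (px (px φ) (X0 + z.re) z.im : ℂ) * Complex.I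

lemma hasDerivAt_cgrad {φ : ℝ → ℝ → ℝ} (hφ : Sm φ) (X0 : ℝ) (z : ℂ)
    (hz : px (px φ) (X0 + z.re) z.im + py (py φ) (X0 + z.re) z.im = 0) :
    HasDerivAt (cgrad φ X0) (cgrad' φ X0 z) z := by
  have h1 := Complex.ofRealCLM.hasFDerivAt.comp z (hφ.sm_py.fderivC X0 z)
  have h2 := Complex.ofRealCLM.hasFDerivAt.comp z (hφ.sm_px.fderivC X0 z)
  have h3 := h1.add (h2.mul_const Complex.I)
  rw [hasDerivAt_iff_hasFDerivAt]
  refine hasFDerivAt_of_restrictScalars ℝ h3 ?_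
  ext v
  have hc := hφ.comm (X0 + z.re) z.im
  have hyy : py (py φ) (X0 + z.re) z.im = - px (px φ) (X0 + z.re) z.im := by linarith
  apply Complex.ext
  · simp [cgrad', hc, hyy]; ring
  · simp [cgrad', hc, hyy]; ring

lemma reflected_hasDerivAt {φ : ℝ → ℝ → ℝ} (hφ : Sm φ) {X0 H : ℝ} (hH : 0 < H)
    (harm : ∀ x y, 0 < y → y < H → px (px φ) x y + py (py φ) x y = 0)
    (h0 : ∀ x, φ x 0 = 0) (z : ℂ) (hz : |z.im| < H) :
    ∃ w, HasDerivAt (fun z : ℂ => if 0 ≤ z.im then cgrad φ X0 z else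
      (starRingEnd ℂ) (cgrad φ X0 ((starRingEnd ℂ) z))) w z := by
  have hx0 : ∀ x, px φ x 0 = 0 := by
    intro x
    have : (fun t => φ t 0) = fun _ => 0 := by ext t; exact h0 t
    simp [px, this]
  have hxx0 : ∀ x, px (px φ) x 0 = 0 := by
    intro x
    have : (fun t => px φ t 0) = fun _ => 0 := by ext t; exact hx0 t
    rw [px, this]; simp
  have harm0 : ∀ x y, 0 ≤ y → y < H → px (px φ) x y + py (py φ) x y = 0 := by
    intro x y h1 h2
    refine eq_on_Icc_of_Ioo (g := fun y => px (px φ) x y + py (py φ) x y) ?_ hH (harm x) h1 h2.le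
    have e1 := hφ.sm_px.sm_px.cont
    have e2 := hφ.sm_py.sm_py.cont
    exact (e1.comp (Continuous.prodMk_right x)).add (e2.comp (Continuous.prodMk_right x))
  have hA : ∀ z : ℂ, 0 ≤ z.im → z.im < H → HasDerivAt (cgrad φ X0) (cgrad' φ X0 z) z :=
    fun z h1 h2 => hasDerivAt_cgrad hφ X0 z (harm0 _ _ h1 h2)
  have hB : ∀ z : ℂ, z.im ≤ 0 → -H < z.im →
      HasDerivAt (fun z => (starRingEnd ℂ) (cgrad φ X0 ((starRingEnd ℂ) z)))
        ((starRingEnd ℂ) (cgrad' φ X0 ((starRingEnd ℂ) z))) z := by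
    intro z h1 h2
    have := (hA ((starRingEnd ℂ) z) (by simpa using h1) (by simp; linarith)).conj_conj
    simpa [Function.comp_def] using this
  rw [abs_lt] at hz
  rcases lt_trichotomy z.im 0 with h | h | h
  · refine ⟨_, (hB z h.le hz.1).congr_of_eventuallyEq ?_⟩
    filter_upwards [(isOpen_lt Complex.continuous_im continuous_const).mem_nhds h] with w hw
    rw [if_neg (not_le.2 hw)]
  · have e1 := (hA z h.ge hz.2).hasDerivWithinAt (s := {w : ℂ | 0 ≤ w.im})
    have e2 := (hB z h.le hz.1).hasDerivWithinAt (s := {w : ℂ | w.im ≤ 0})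
    have ew : (starRingEnd ℂ) (cgrad' φ X0 ((starRingEnd ℂ) z)) = cgrad' φ X0 z := by
      apply Complex.ext <;> simp [cgrad', h, hxx0]
    have eval : ∀ w : ℂ, w.im = 0 →
        (starRingEnd ℂ) (cgrad φ X0 ((starRingEnd ℂ) w)) = cgrad φ X0 w := by
      intro w hw
      apply Complex.ext <;> simp [cgrad, hw, hx0]
    rw [ew] at e2
    refine ⟨cgrad' φ X0 z, ?_⟩
    rw [← hasDerivWithinAt_univ]
    have hu : (univ : Set ℂ) = {w : ℂ | 0 ≤ w.im} ∪ {w : ℂ | w.im ≤ 0} := by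
      ext w; simp [le_total]
    rw [hu]
    refine HasDerivWithinAt.union (e1.congr_of_mem ?_ h.ge) (e2.congr_of_mem ?_ h.le)
    · intro w hw
      exact if_pos hw
    · intro w hw
      rcases (show w.im ≤ 0 from hw).eq_or_lt with h' | h'
      · rw [if_pos h'.ge, eval w h']
      · exact if_neg (not_le.2 h')
  · refine ⟨_, (hA z h.le hz.2).congr_of_eventuallyEq ?_⟩
    filter_upwards [(isOpen_lt continuous_const Complex.continuous_im).mem_nhds h] with w hw
    rw [if_pos (show 0 ≤ w.im from le_of_lt hw)]

/-- A typically real holomorphic function whose imaginary part is the odd extension of `φ`. -/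
lemma exists_typically_real {φ : ℝ → ℝ → ℝ} (hφ : Sm φ) {X0 H : ℝ} (hH : 0 < H)
    (harm : ∀ x y, 0 < y → y < H → px (px φ) x y + py (py φ) x y = 0)
    (h0 : ∀ x, φ x 0 = 0) :
    ∃ T : ℂ → ℂ, DifferentiableOn ℂ T (Metric.ball 0 H) ∧ T 0 = 0 ∧
      HasDerivAt T (py φ X0 0 : ℂ) 0 ∧
      ∀ z ∈ Metric.ball (0 : ℂ) H, (0 ≤ z.im → (T z).im = φ (X0 + z.re) z.im) ∧
        (z.im < 0 → (T z).im = - φ (X0 + z.re) (- z.im)) := by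
  set G : ℂ → ℂ := fun z : ℂ => if 0 ≤ z.im then cgrad φ X0 z else
      (starRingEnd ℂ) (cgrad φ X0 ((starRingEnd ℂ) z)) with hG
  have hGd : DifferentiableOn ℂ G (Metric.ball 0 H) := by
    intro z hz
    have hz' : ‖z‖ < H := by simpa using hz
    obtain ⟨w, hw⟩ := reflected_hasDerivAt hφ (X0 := X0) hH harm h0 z
      (lt_of_le_of_lt (Complex.abs_im_le_norm z) hz')
    exact hw.differentiableAt.differentiableWithinAt
  obtain ⟨T, hT0, hT⟩ := hGd.isExactOn_ball.with_val_at 0 0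
  refine ⟨T, fun z hz => (hT z hz).differentiableAt.differentiableWithinAt, hT0, ?_, ?_⟩
  · have h1 := hT 0 (by simpa using hH)
    have : G 0 = (py φ X0 0 : ℂ) := by
      have hx0 : px φ X0 0 = 0 := by
        have : (fun t => φ t 0) = fun _ => 0 := by ext t; exact h0 t
        simp [px, this]
      simp [hG, cgrad, hx0]
    rwa [this] at h1
  intro z hz
  have hz' : ‖z‖ < H := by simpa using hz
  have hray : ∀ t ∈ Icc (0 : ℝ) 1, ((t : ℂ) * z) ∈ Metric.ball (0 : ℂ) H := by
    intro t ht
    rw [mem_ball_zero_iff, norm_mul, Complex.norm_real, Real.norm_of_nonneg ht.1]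
    nlinarith [ht.2, norm_nonneg z, ht.1]
  have hTray : ∀ t ∈ Icc (0 : ℝ) 1,
      HasDerivAt (fun t : ℝ => (T ((t : ℂ) * z)).im) ((G ((t : ℂ) * z) * z).im) t := by
    intro t ht
    have h1 := hT _ (hray t ht)
    have h2 : HasDerivAt (fun s : ℂ => s * z) z (t : ℂ) := by
      simpa using (hasDerivAt_id (t : ℂ)).mul_const z
    have h3 : HasDerivAt (fun s : ℂ => T (s * z)) (G ((t : ℂ) * z) * z) (t : ℂ) :=
      HasDerivAt.comp (t : ℂ) h1 h2
    have h4 := h3.comp_ofReal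
    have h5 := Complex.imCLM.hasFDerivAt.comp_hasDerivAt t h4
    exact h5
  -- generic conclusion: equal derivatives along the ray
  have concl : ∀ q : ℝ → ℝ, q 0 = 0 →
      (∀ t ∈ Icc (0 : ℝ) 1, HasDerivAt q ((G ((t : ℂ) * z) * z).im) t) →
      (T z).im = q 1 := by
    intro q hq0 hq
    have hd : ∀ t ∈ Icc (0 : ℝ) 1,
        HasDerivAt (fun t : ℝ => (T ((t : ℂ) * z)).im - q t) 0 t := by
      intro t ht
      have h := (hTray t ht).sub (hq t ht)
      rw [sub_self] at h
      exact h
    have := constant_of_has_deriv_right_zero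
      (fun t ht => (hd t ht).continuousAt.continuousWithinAt)
      (fun t ht => (hd t (Ico_subset_Icc_self ht)).hasDerivWithinAt) 1 (by simp)
    simp [hT0, hq0] at this
    linarith
  constructor
  · intro hi
    have := concl (fun t => φ (X0 + t * z.re) (t * z.im)) (by simp [h0]) ?_
    · simpa using this
    intro t ht
    have ha : HasDerivAt (fun t : ℝ => X0 + t * z.re) z.re t := by
      simpa using ((hasDerivAt_id t).mul_const z.re).const_add X0
    have hb : HasDerivAt (fun t : ℝ => t * z.im) z.im t := by
      simpa using (hasDerivAt_id t).mul_const z.im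
    refine (hφ.chain ha hb).congr_deriv ?_
    have : 0 ≤ ((t : ℂ) * z).im := by simpa using mul_nonneg ht.1 hi
    simp only [hG, if_pos this]
    simp [cgrad]; ring
  · intro hi
    have := concl (fun t => - φ (X0 + t * z.re) (t * (- z.im))) (by simp [h0]) ?_
    · simpa using this
    intro t ht
    have ha : HasDerivAt (fun t : ℝ => X0 + t * z.re) z.re t := by
      simpa using ((hasDerivAt_id t).mul_const z.re).const_add X0
    have hb : HasDerivAt (fun t : ℝ => t * (- z.im)) (- z.im) t := by
      simpa using (hasDerivAt_id t).mul_const (- z.im)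
    refine (hφ.chain ha hb).neg.congr_deriv ?_
    rcases ht.1.eq_or_lt with rfl | ht0
    · have hx0 : px φ X0 0 = 0 := by
        have : (fun t => φ t 0) = fun _ => 0 := by ext t; exact h0 t
        simp [px, this]
      simp [hG, cgrad, hx0]
    have : ¬ 0 ≤ ((t : ℂ) * z).im := by
      simp only [Complex.im_ofReal_mul, not_le]
      exact mul_neg_of_pos_of_neg ht0 hi
    simp only [hG, if_neg this]
    simp [cgrad]

lemma halfdisc {φ : ℝ → ℝ → ℝ} (hφ : Sm φ) {X0 H ρ : ℝ} (hρ : 0 < ρ) (hρH : ρ < H)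
    (harm : ∀ x y, 0 < y → y < H → px (px φ) x y + py (py φ) x y = 0)
    (h0 : ∀ x, φ x 0 = 0) (hpos : ∀ x y, 0 ≤ y → y < H → 0 ≤ φ x y) :
    (∀ y, 0 < y → y < ρ →
      φ X0 y * (ρ ^ 2 + y ^ 2) * (ρ - y) ≤ ρ ^ 2 * py φ X0 0 * y * (ρ + y) ∧
      ρ ^ 2 * py φ X0 0 * y * (ρ - y) ≤ φ X0 y * (ρ ^ 2 + y ^ 2) * (ρ + y)) ∧
    (py φ X0 0 = 0 → ∀ x y, 0 ≤ y → x ^ 2 + y ^ 2 < ρ ^ 2 → φ (X0 + x) y = 0) := by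
  have hH : 0 < H := hρ.trans hρH
  obtain ⟨T, hTd, hT0, hT', hTim⟩ := exists_typically_real hφ (X0 := X0) hH harm h0
  set p : ℂ → ℂ := fun z => dslope T 0 z * ((ρ : ℂ) ^ 2 - z ^ 2) with hp
  have hsub : Metric.closedBall (0 : ℂ) ρ ⊆ Metric.ball 0 H := Metric.closedBall_subset_ball hρH
  have hds : DifferentiableOn ℂ (dslope T 0) (Metric.ball 0 H) :=
    (Complex.differentiableOn_dslope (Metric.ball_mem_nhds 0 hH)).2 hTd
  have hpd : DifferentiableOn ℂ p (Metric.ball 0 H) := by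
    apply hds.mul
    fun_prop
  have hp0 : p 0 = ((ρ ^ 2 * py φ X0 0 : ℝ) : ℂ) := by
    simp [hp, hT'.deriv]; ring
  have hpz : ∀ z, z ≠ 0 → p z = T z / z * ((ρ : ℂ) ^ 2 - z ^ 2) := by
    intro z hz
    simp only [hp]
    rw [dslope_of_ne _ hz, slope_def_field, hT0]
    simp
  have hbd : ∀ z ∈ Metric.sphere (0 : ℂ) ρ, 0 ≤ (p z).re := by
    intro z hz
    have hzn : ‖z‖ = ρ := by simpa using hz
    have hz0 : z ≠ 0 := by
      intro h; rw [h] at hzn; simp at hzn; linarith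
    have hzH : z ∈ Metric.ball (0 : ℂ) H := by simpa [hzn] using hρH
    have hkey : ((ρ : ℂ) ^ 2 - z ^ 2) = z * (((-2 * z.im : ℝ) : ℂ) * Complex.I) := by
      have h1 : z * (starRingEnd ℂ) z = (ρ : ℂ) ^ 2 := by
        rw [Complex.mul_conj, Complex.normSq_eq_norm_sq, hzn]; push_cast; ring
      rw [← h1]
      have h2 : (starRingEnd ℂ) z - z = ((-2 * z.im : ℝ) : ℂ) * Complex.I := by
        apply Complex.ext
        · simp
        · simp; ring
      rw [← h2]; ring
    have h3 : p z = T z * (((-2 * z.im : ℝ) : ℂ) * Complex.I) := by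
      rw [hpz z hz0, hkey]; field_simp
    have h4 : (p z).re = 2 * (z.im * (T z).im) := by
      rw [h3]; simp; ring
    rw [h4]
    have hi : |z.im| < H := lt_of_le_of_lt (Complex.abs_im_le_norm z) (by rw [hzn]; exact hρH)
    rw [abs_lt] at hi
    rcases le_or_gt 0 z.im with h | h
    · rw [(hTim z hzH).1 h]
      have := hpos (X0 + z.re) z.im h hi.2
      positivity
    · rw [(hTim z hzH).2 h]
      have := hpos (X0 + z.re) (-z.im) (by linarith) (by linarith)
      nlinarith
  have hre : ∀ z ∈ Metric.closedBall (0 : ℂ) ρ, 0 ≤ (p z).re := by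
    intro z hz
    have hE : DiffContOnCl ℂ (fun z => Complex.exp (- p z)) (Metric.ball 0 ρ) := by
      apply DifferentiableOn.diffContOnCl
      rw [closure_ball _ hρ.ne']
      exact ((hpd.mono hsub).neg).cexp
    have := Complex.norm_le_of_forall_mem_frontier_norm_le (C := 1) Metric.isBounded_ball hE
      (by
        intro w hw
        rw [frontier_ball _ hρ.ne'] at hw
        rw [Complex.norm_exp]
        simpa using hbd w hw) (by rwa [closure_ball _ hρ.ne'] : z ∈ closure (Metric.ball 0 ρ))
    rw [Complex.norm_exp] at this
    simpa using this
  have hk : 0 ≤ ρ ^ 2 * py φ X0 0 := by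
    have := hre 0 (by simp [hρ.le])
    rw [hp0, Complex.ofReal_re] at this
    exact this
  have hC := fun z hz => carath_nonneg hk (hpd.mono (Metric.ball_subset_closedBall.trans hsub))
    (fun z hz => hre z (Metric.ball_subset_closedBall hz)) hp0 (z := z) hz
  constructor
  · intro y hy hyρ
    have hyn : ‖(y : ℂ) * Complex.I‖ = y := by simp [abs_of_pos hy]
    have hb : (y : ℂ) * Complex.I ∈ Metric.ball (0 : ℂ) ρ := by
      rw [mem_ball_zero_iff, hyn]; exact hyρ
    have hbH := hsub (Metric.ball_subset_closedBall hb)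
    have h1 := hC _ hb
    rw [hyn] at h1
    have hne : (y : ℂ) * Complex.I ≠ 0 := by simp [hy.ne']
    have him := (hTim _ hbH).1 (by simp [hy.le])
    simp only [Complex.re_ofReal_mul, Complex.I_re, mul_zero, add_zero, Complex.im_ofReal_mul,
      Complex.I_im, mul_one] at him
    have hpre : (p (y * Complex.I)).re * y = φ X0 y * (ρ ^ 2 + y ^ 2) := by
      have e1 : p (y * Complex.I) * (y * Complex.I) =
          T (y * Complex.I) * ((ρ ^ 2 + y ^ 2 : ℝ) : ℂ) := by
        have hyc : (y : ℂ) ≠ 0 := by exact_mod_cast hy.ne'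
        rw [hpz _ hne]
        field_simp
        have : Complex.I ^ 2 = -1 := Complex.I_sq
        rw [this]
        push_cast
        ring
      have e2 := congrArg Complex.im e1
      rw [mul_comm (T _), Complex.im_ofReal_mul, him] at e2
      simp at e2
      linarith
    have hle : (p (y * Complex.I)).re ≤ ‖p (y * Complex.I)‖ := Complex.re_le_norm _
    have hρy : 0 < ρ - y := by linarith
    rw [← hpre]
    constructor
    · have := h1.1
      have h2 : (p (y * Complex.I)).re * (ρ - y) ≤ ρ ^ 2 * py φ X0 0 * (ρ + y) :=
        (mul_le_mul_of_nonneg_right hle hρy.le).trans this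
      nlinarith
    · nlinarith [h1.2]
  · intro hk0 x y hy hxy
    set z : ℂ := ⟨x, y⟩ with hz
    have hzn : ‖z‖ < ρ := by
      rw [← sq_lt_sq₀ (norm_nonneg _) hρ.le, ← Complex.normSq_eq_norm_sq, Complex.normSq_apply]
      simp only [hz]; nlinarith
    have hb : z ∈ Metric.ball (0 : ℂ) ρ := by simpa using hzn
    have h1 := (hC z hb).1
    rw [hk0] at h1
    have hp00 : p z = 0 := by
      rw [← norm_le_zero_iff]
      by_contra hcon
      push Not at hcon
      have : 0 < ‖p z‖ * (ρ - ‖z‖) := mul_pos hcon (by linarith)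
      simp at h1
      linarith
    by_cases hz0 : z = 0
    · have : x = 0 ∧ y = 0 := by
        have e1 := congrArg Complex.re hz0
        have e2 := congrArg Complex.im hz0
        simpa [hz] using And.intro e1 e2
      rw [this.2]; exact h0 _
    have hT : T z = 0 := by
      rw [hpz z hz0] at hp00
      rcases mul_eq_zero.1 hp00 with h | h
      · rcases div_eq_zero_iff.1 h with h | h
        · exact h
        · exact absurd h hz0
      · exfalso
        have h2 : (ρ : ℂ) ^ 2 = z ^ 2 := sub_eq_zero.1 h
        have h3 := congrArg norm h2
        rw [norm_pow, norm_pow, Complex.norm_real, Real.norm_of_nonneg hρ.le] at h3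
        nlinarith [norm_nonneg z]
    have := (hTim z (hsub (Metric.ball_subset_closedBall hb))).1 hy
    rw [hT] at this
    simpa [hz] using this.symm


/-! ### Minimum principle -/

/-- `α ψ + β y² + δ y`. -/
def qd (α β δ : ℝ) (ψ : ℝ → ℝ → ℝ) (x y : ℝ) : ℝ := α * ψ x y + β * y ^ 2 + δ * y

lemma Sm.qd {ψ : ℝ → ℝ → ℝ} (h : Sm ψ) (α β δ : ℝ) : Sm (qd α β δ ψ) := by
  have h' : ContDiff ℝ (⊤ : ℕ∞) (fun p : ℝ × ℝ => ψ p.1 p.2) := h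
  have h2 : ContDiff ℝ (⊤ : ℕ∞) (fun p : ℝ × ℝ => p.2) := contDiff_snd
  exact ((contDiff_const.mul h').add (contDiff_const.mul (h2.pow 2))).add (contDiff_const.mul h2)

lemma px_qd {ψ : ℝ → ℝ → ℝ} (h : Sm ψ) (α β δ : ℝ) :
    px (qd α β δ ψ) = fun x y => α * px ψ x y := by
  ext x y
  exact ((((h.dx x y).const_mul α).add_const (β * y ^ 2)).add_const (δ * y)).deriv

lemma py_qd {ψ : ℝ → ℝ → ℝ} (h : Sm ψ) (α β δ : ℝ) :
    py (qd α β δ ψ) = fun x y => α * py ψ x y + 2 * β * y + δ := by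
  ext x y
  have h1 := (((h.dy x y).const_mul α).add (((hasDerivAt_id y).pow 2).const_mul β)).add
    ((hasDerivAt_id y).const_mul δ)
  have h2 := h1.deriv
  have h3 : py (qd α β δ ψ) x y = α * py ψ x y + β * (2 * y) + δ := by
    refine Eq.trans (Eq.trans ?_ h2) ?_
    · rfl
    · simp
  rw [h3]; ring

lemma lap_qd {ψ : ℝ → ℝ → ℝ} (h : Sm ψ) (α β δ x y : ℝ) :
    px (px (qd α β δ ψ)) x y + py (py (qd α β δ ψ)) x y =
      α * (px (px ψ) x y + py (py ψ) x y) + 2 * β := by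
  rw [px_qd h, py_qd h]
  have h1 : px (fun x y => α * px ψ x y) x y = α * px (px ψ) x y :=
    ((h.sm_px.dx x y).const_mul α).deriv
  have h2 : py (fun x y => α * py ψ x y + 2 * β * y + δ) x y = α * py (py ψ) x y + 2 * β := by
    have := (((h.sm_py.dy x y).const_mul α).add ((hasDerivAt_id y).const_mul (2 * β))).add_const δ
    refine Eq.trans (Eq.trans ?_ this.deriv) ?_
    · rfl
    · simp
  rw [h1, h2]; ring

lemma second_deriv_nonneg {u : ℝ → ℝ} {t : ℝ} (hu : Continuous u) (h : IsLocalMin u t) :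
    0 ≤ deriv (deriv u) t := by
  by_contra hcon
  push Not at hcon
  have h1 : IsLocalMax u t := isLocalMax_of_deriv_deriv_neg hcon h.deriv_eq_zero hu.continuousAt
  have h2 : u =ᶠ[nhds t] fun _ => u t := by
    filter_upwards [h, h1] with s hs hs1
    exact le_antisymm hs1 hs
  have h3 : deriv u =ᶠ[nhds t] deriv (fun _ => u t) := h2.deriv
  have h4 := h3.deriv_eq
  simp at h4
  linarith

lemma lap_nonneg_of_min {f : ℝ → ℝ → ℝ} (hf : Sm f) {p : ℝ × ℝ}
    (h : IsLocalMin (fun p : ℝ × ℝ => f p.1 p.2) p) :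
    0 ≤ px (px f) p.1 p.2 + py (py f) p.1 p.2 := by
  have c1 : Continuous (fun t : ℝ => (t, p.2)) := by fun_prop
  have c2 : Continuous (fun t : ℝ => (p.1, t)) := by fun_prop
  have h1 : IsLocalMin (fun t => f t p.2) p.1 :=
    (c1.tendsto p.1).eventually h
  have h2 : IsLocalMin (fun t => f p.1 t) p.2 :=
    (c2.tendsto p.2).eventually h
  exact add_nonneg (second_deriv_nonneg (hf.cont.comp c1) h1)
    (second_deriv_nonneg (hf.cont.comp c2) h2)

lemma min_principle {f : ℝ → ℝ → ℝ} (hf : Sm f) {S K : Set (ℝ × ℝ)} (hK : IsCompact K)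
    (hrep : ∀ p ∈ S, ∃ q ∈ K, q.2 = p.2 ∧ f q.1 q.2 = f p.1 p.2)
    (hinn : ∀ p ∈ K, f p.1 p.2 < 0 → S ∈ nhds p ∧
      px (px f) p.1 p.2 + py (py f) p.1 p.2 = 0) :
    ∀ p ∈ S, 0 ≤ f p.1 p.2 := by
  intro p hp
  by_contra hneg
  push Not at hneg
  obtain ⟨q0, hq0, -, -⟩ := hrep p hp
  have hbd : ∃ M > 0, ∀ q ∈ K, q.2 ^ 2 ≤ M := by
    obtain ⟨M, hM⟩ := (hK.image (f := fun q : ℝ × ℝ => q.2 ^ 2) (by fun_prop)).bddAbove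
    exact ⟨max M 1, by positivity, fun q hq => (hM ⟨q, hq, rfl⟩).trans (le_max_left _ _)⟩
  obtain ⟨M, hM0, hM⟩ := hbd
  set τ := (- f p.1 p.2) / (2 * M) with hτ
  have hτ0 : 0 < τ := by apply div_pos <;> linarith
  have hτM : τ * M = - f p.1 p.2 / 2 := by rw [hτ]; field_simp
  have hg := hf.qd 1 (-τ) 0
  obtain ⟨q, hqK, hq⟩ := hK.exists_isMinOn ⟨q0, hq0⟩ hg.cont.continuousOn
  have hqS : ∀ w ∈ S, qd 1 (-τ) 0 f q.1 q.2 ≤ qd 1 (-τ) 0 f w.1 w.2 := by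
    intro w hw
    obtain ⟨w', hw', e1, e2⟩ := hrep w hw
    have : qd 1 (-τ) 0 f q.1 q.2 ≤ qd 1 (-τ) 0 f w'.1 w'.2 := hq hw'
    unfold qd at *
    rw [e2, e1] at this
    exact this
  have h1 := hqS p hp
  have hfq : f q.1 q.2 < 0 := by
    simp only [qd] at h1
    nlinarith [hM q hqK, sq_nonneg p.2]
  obtain ⟨hS, hlap⟩ := hinn q hqK hfq
  have hmin : IsLocalMin (fun p : ℝ × ℝ => qd 1 (-τ) 0 f p.1 p.2) q := by
    filter_upwards [hS] with w hw
    exact hqS w hw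
  have := lap_nonneg_of_min hg hmin
  rw [lap_qd hf, hlap] at this
  linarith

/-! ### Scaled waves -/

structure SW (ε Λ : ℝ) (ψ : ℝ → ℝ → ℝ) (η : ℝ → ℝ) : Prop where
  eta_smooth : ContDiff ℝ (⊤ : ℕ∞) η
  eta_pos : ∀ x, 0 < η x
  psi : Sm ψ
  lap : ∀ x y, 0 < y → y < η x → px (px ψ) x y + py (py ψ) x y = 2
  bern : ∀ x, px ψ x (η x) ^ 2 + py ψ x (η x) ^ 2 = 4 + 2 * ε * (1 - η x)
  surf : ∀ x, ψ x (η x) = 1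
  bot : ∀ x, ψ x 0 = 0
  lam_pos : 0 < Λ
  eta_per : ∀ x, η (x + 2 * Λ) = η x
  eta_even : ∀ x, η (-x) = η x
  psi_per : ∀ x y, ψ (x + 2 * Λ) y = ψ x y
  psi_even : ∀ x y, ψ (-x) y = ψ x y
  eta_anti : StrictAntiOn η (Icc 0 Λ)
  uni : ∀ x y, 0 < y → y < η x → 0 < py ψ x y

namespace SW
variable {ε Λ : ℝ} {ψ : ℝ → ℝ → ℝ} {η : ℝ → ℝ}

lemma eta_cont (h : SW ε Λ ψ η) : Continuous η := h.eta_smooth.continuous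

lemma red (h : SW ε Λ ψ η) (x : ℝ) :
    ∃ x' ∈ Icc 0 Λ, η x' = η x ∧ ∀ y, ψ x' y = ψ x y := by
  have hp : 0 < 2 * Λ := by linarith [h.lam_pos]
  have p1 : Function.Periodic η (2 * Λ) := h.eta_per
  have p2 : ∀ y, Function.Periodic (fun t => ψ t y) (2 * Λ) := fun y t => h.psi_per t y
  set z := toIcoMod hp (-Λ) x with hz
  have hmem : z ∈ Ico (-Λ) (-Λ + 2 * Λ) := toIcoMod_mem_Ico hp (-Λ) x
  have hzx : z = x - toIcoDiv hp (-Λ) x • (2 * Λ) := rfl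
  have e1 : η z = η x := by rw [hzx]; exact p1.sub_zsmul_eq _
  have e2 : ∀ y, ψ z y = ψ x y := by
    intro y; rw [hzx]; exact (p2 y).sub_zsmul_eq _
  rcases le_total 0 z with h0 | h0
  · exact ⟨z, ⟨h0, by linarith [hmem.2]⟩, e1, e2⟩
  · refine ⟨-z, ⟨by linarith, by linarith [hmem.1]⟩, ?_, ?_⟩
    · rw [h.eta_even, e1]
    · intro y; rw [h.psi_even, e2]

lemma eta_le (h : SW ε Λ ψ η) (x : ℝ) : η x ≤ η 0 := by
  obtain ⟨x', hx', e, -⟩ := h.red x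
  rw [← e]
  exact h.eta_anti.antitoneOn ⟨le_rfl, h.lam_pos.le⟩ hx' hx'.1

lemma le_eta (h : SW ε Λ ψ η) (x : ℝ) : η Λ ≤ η x := by
  obtain ⟨x', hx', e, -⟩ := h.red x
  rw [← e]
  exact h.eta_anti.antitoneOn hx' ⟨h.lam_pos.le, le_rfl⟩ hx'.2

lemma trough_lt_crest (h : SW ε Λ ψ η) : η Λ < η 0 :=
  h.eta_anti ⟨le_rfl, h.lam_pos.le⟩ ⟨h.lam_pos.le, le_rfl⟩ h.lam_pos

lemma py_nonneg (h : SW ε Λ ψ η) (x : ℝ) {y : ℝ} (h1 : 0 ≤ y) (h2 : y ≤ η x) : 0 ≤ py ψ x y :=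
  le_on_Icc_of_Ioo (g := fun y => py ψ x y)
    (h.psi.sm_py.cont.comp (Continuous.prodMk_right x)) (h.eta_pos x)
    (fun y a b => (h.uni x y a b).le) h1 h2

lemma px_crest (h : SW ε Λ ψ η) (y : ℝ) : px ψ 0 y = 0 := by
  have h1 : HasDerivAt (fun t => ψ t y) (px ψ 0 y) (-0) := by simpa using h.psi.dx 0 y
  have h2 := h1.comp (0 : ℝ) (hasDerivAt_neg (0 : ℝ))
  have h3 : ((fun t => ψ t y) ∘ Neg.neg) = fun t => ψ t y := by
    ext t; exact h.psi_even t y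
  rw [h3] at h2
  have := h2.unique (h.psi.dx 0 y)
  linarith

lemma psi_reflect (h : SW ε Λ ψ η) (x y : ℝ) : ψ (2 * Λ - x) y = ψ x y := by
  rw [← h.psi_even x, ← h.psi_per (-x)]; congr 1; ring

lemma px_trough (h : SW ε Λ ψ η) (y : ℝ) : px ψ Λ y = 0 := by
  have h1 : HasDerivAt (fun t => ψ t y) (px ψ Λ y) (2 * Λ - Λ) := by
    have := h.psi.dx Λ y
    rwa [show 2 * Λ - Λ = Λ by ring]
  have h2 := h1.comp Λ ((hasDerivAt_id Λ).const_sub (2 * Λ))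
  have h3 : ((fun t => ψ t y) ∘ HSub.hSub (2 * Λ)) = fun t => ψ t y := by
    ext t; exact h.psi_reflect t y
  rw [h3] at h2
  have := h2.unique (h.psi.dx Λ y)
  linarith

lemma px_bot (h : SW ε Λ ψ η) (x : ℝ) : px ψ x 0 = 0 := by
  have : (fun t => ψ t 0) = fun _ => 0 := by ext t; exact h.bot t
  simp [px, this]

lemma eta_deriv (h : SW ε Λ ψ η) (x : ℝ) : HasDerivAt η (deriv η x) x :=
  (h.eta_smooth.differentiable (by simp) x).hasDerivAt

/-- The kinematic boundary condition. -/
lemma kin (h : SW ε Λ ψ η) (x : ℝ) : px ψ x (η x) + py ψ x (η x) * deriv η x = 0 := by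
  have h1 := h.psi.chain (hasDerivAt_id x) (h.eta_deriv x)
  have h2 : (fun s => ψ (id s) (η s)) = fun _ => 1 := by ext s; exact h.surf s
  rw [h2] at h1
  have := h1.unique (hasDerivAt_const x (1 : ℝ))
  simpa using this

/-- The half cell. -/
def cell (Λ : ℝ) (η : ℝ → ℝ) : Set (ℝ × ℝ) :=
  {p | 0 ≤ p.1 ∧ p.1 ≤ Λ ∧ 0 ≤ p.2 ∧ p.2 ≤ η p.1}

lemma cell_compact (h : SW ε Λ ψ η) : IsCompact (cell Λ η) := by
  have hc := h.eta_cont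
  refine (isCompact_Icc.prod isCompact_Icc : IsCompact (Icc 0 Λ ×ˢ Icc 0 (η 0))).of_isClosed_subset
    ?_ ?_
  · refine (isClosed_le continuous_const continuous_fst).inter
      ((isClosed_le continuous_fst continuous_const).inter
      ((isClosed_le continuous_const continuous_snd).inter
        (isClosed_le continuous_snd (hc.comp continuous_fst))))
  · rintro p ⟨a, b, c, d⟩
    exact ⟨⟨a, b⟩, ⟨c, d.trans (h.eta_le _)⟩⟩

/-- Minimum principle in the fluid domain for `α ψ + β y² + δ y`. -/
lemma min_strip (h : SW ε Λ ψ η) {α β δ : ℝ} (hαβ : α + β = 0)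
    (hs : ∀ x, 0 ≤ α + β * η x ^ 2 + δ * η x) {x y : ℝ} (h1 : 0 ≤ y) (h2 : y ≤ η x) :
    0 ≤ qd α β δ ψ x y := by
  refine min_principle (h.psi.qd α β δ) (S := {p | 0 ≤ p.2 ∧ p.2 ≤ η p.1}) h.cell_compact
    ?_ ?_ (x, y) ⟨h1, h2⟩
  · rintro ⟨x, y⟩ ⟨a, b⟩
    obtain ⟨x', hx', e1, e2⟩ := h.red x
    refine ⟨(x', y), ⟨hx'.1, hx'.2, a, by simpa [e1] using b⟩, rfl, ?_⟩
    simp only [qd, e2]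
  · rintro ⟨x, y⟩ ⟨-, -, a, b⟩ hneg
    simp only at a b hneg ⊢
    have hy0 : 0 < y := by
      rcases a.eq_or_lt with e | e
      · rw [← e] at hneg; simp [qd, h.bot] at hneg
      · exact e
    have hy1 : y < η x := by
      rcases b.eq_or_lt with e | e
      · rw [e] at hneg; simp only [qd, h.surf] at hneg; linarith [hs x]
      · exact e
    constructor
    · have ho : IsOpen {p : ℝ × ℝ | 0 < p.2 ∧ p.2 < η p.1} :=
        (isOpen_lt continuous_const continuous_snd).inter
          (isOpen_lt continuous_snd (h.eta_cont.comp continuous_fst))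
      filter_upwards [ho.mem_nhds (show (x, y) ∈ _ from ⟨hy0, hy1⟩)] with p hp
      exact ⟨hp.1.le, hp.2.le⟩
    · rw [lap_qd h.psi, h.lap x y hy0 hy1]; linarith

lemma lap_px (h : SW ε Λ ψ η) {x y : ℝ} (h1 : 0 < y) (h2 : y < η x) :
    px (px (px ψ)) x y + py (py (px ψ)) x y = 0 := by
  have e : py (py (px ψ)) x y = px (py (py ψ)) x y := by
    have : py (px ψ) = px (py ψ) := by ext a b; exact (h.psi.comm a b).symm
    rw [this, h.psi.sm_py.comm]
  rw [e]
  have h3 := (h.psi.sm_px.sm_px.dx x y).add (h.psi.sm_py.sm_py.dx x y)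
  have h4 : (fun t => px (px ψ) t y + py (py ψ) t y) =ᶠ[nhds x] fun _ => 2 := by
    filter_upwards [(isOpen_lt continuous_const h.eta_cont).mem_nhds h2] with t ht
    exact h.lap t y h1 ht
  have h5 : HasDerivAt (fun t => px (px ψ) t y + py (py ψ) t y) 0 x :=
    (hasDerivAt_const x (2 : ℝ)).congr_of_eventuallyEq h4
  exact h3.unique h5

lemma deriv_eta_nonpos (h : SW ε Λ ψ η) {x : ℝ} (h0 : 0 < x) (h1 : x < Λ) : deriv η x ≤ 0 := by
  have := h.eta_anti.antitoneOn.derivWithin_nonpos (x := x)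
  rwa [derivWithin_of_mem_nhds (Icc_mem_nhds h0 h1)] at this

lemma px_nonneg (h : SW ε Λ ψ η) {x y : ℝ} (h0 : 0 ≤ x) (h1 : x ≤ Λ) (h2 : 0 ≤ y)
    (h3 : y ≤ η x) : 0 ≤ px ψ x y := by
  refine min_principle h.psi.sm_px (S := cell Λ η) h.cell_compact (fun p hp => ⟨p, hp, rfl, rfl⟩)
    ?_ (x, y) ⟨h0, h1, h2, h3⟩
  rintro ⟨x, y⟩ ⟨a, b, c, d⟩ hneg
  simp only at a b c d hneg ⊢
  have hx0 : 0 < x := by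
    rcases a.eq_or_lt with e | e
    · rw [← e, h.px_crest] at hneg; linarith
    · exact e
  have hx1 : x < Λ := by
    rcases b.eq_or_lt with e | e
    · rw [e, h.px_trough] at hneg; linarith
    · exact e
  have hy0 : 0 < y := by
    rcases c.eq_or_lt with e | e
    · rw [← e, h.px_bot] at hneg; linarith
    · exact e
  have hy1 : y < η x := by
    rcases d.eq_or_lt with e | e
    · rw [e] at hneg
      have h4 := h.kin x
      have h5 := h.deriv_eta_nonpos hx0 hx1
      have h6 := h.py_nonneg x (h.eta_pos x).le le_rfl
      nlinarith
    · exact e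
  refine ⟨?_, h.lap_px hy0 hy1⟩
  have ho : IsOpen {p : ℝ × ℝ | (0 < p.1 ∧ p.1 < Λ) ∧ (0 < p.2 ∧ p.2 < η p.1)} :=
    ((isOpen_lt continuous_const continuous_fst).inter
      (isOpen_lt continuous_fst continuous_const)).inter
    ((isOpen_lt continuous_const continuous_snd).inter
      (isOpen_lt continuous_snd (h.eta_cont.comp continuous_fst)))
  filter_upwards [ho.mem_nhds (show (x, y) ∈ _ from ⟨⟨hx0, hx1⟩, hy0, hy1⟩)] with p hp
  exact ⟨hp.1.1.le, hp.1.2.le, hp.2.1.le, hp.2.2.le⟩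

lemma pyy_crest (h : SW ε Λ ψ η) {y : ℝ} (h1 : 0 < y) (h2 : y < η 0) : py (py ψ) 0 y ≤ 2 := by
  have h3 := (h.psi.sm_px.dx 0 y).hasDerivWithinAt (s := Ioi 0)
  rw [hasDerivWithinAt_iff_tendsto_slope' (by simp)] at h3
  have h4 : 0 ≤ px (px ψ) 0 y := by
    refine ge_of_tendsto h3 ?_
    have ev : ∀ᶠ t in nhdsWithin (0 : ℝ) (Ioi 0), y < η t ∧ t < Λ :=
      nhdsWithin_le_nhds (Filter.inter_mem
        ((isOpen_lt continuous_const h.eta_cont).mem_nhds h2) (isOpen_Iio.mem_nhds h.lam_pos))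
    filter_upwards [ev, self_mem_nhdsWithin] with t ht ht0
    rw [slope_def_field, h.px_crest, sub_zero, sub_zero]
    exact div_nonneg (h.px_nonneg (le_of_lt ht0) ht.2.le h1.le ht.1.le) (le_of_lt ht0)
  linarith [h.lap 0 y h1 h2]

lemma pyy_trough (h : SW ε Λ ψ η) {y : ℝ} (h1 : 0 < y) (h2 : y < η Λ) :
    2 ≤ py (py ψ) Λ y := by
  have h3 := (h.psi.sm_px.dx Λ y).hasDerivWithinAt (s := Iio Λ)
  rw [hasDerivWithinAt_iff_tendsto_slope' (by simp)] at h3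
  have h4 : px (px ψ) Λ y ≤ 0 := by
    refine le_of_tendsto h3 ?_
    have ev : ∀ᶠ t in nhdsWithin Λ (Iio Λ), 0 < t :=
      nhdsWithin_le_nhds (isOpen_Ioi.mem_nhds h.lam_pos)
    filter_upwards [ev, self_mem_nhdsWithin] with t ht ht0
    have ht0' : t < Λ := ht0
    rw [slope_def_field, h.px_trough, sub_zero]
    exact div_nonpos_of_nonneg_of_nonpos
      (h.px_nonneg ht.le ht0'.le h1.le (h2.le.trans (h.le_eta t))) (by linarith)
  linarith [h.lap Λ y h1 h2]

/-- On the crest line `ψ_y - 2y` is nonincreasing. -/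
lemma crest_slope (h : SW ε Λ ψ η) {y : ℝ} (h1 : 0 ≤ y) (h2 : y ≤ η 0) :
    py ψ 0 (η 0) - 2 * η 0 ≤ py ψ 0 y - 2 * y := by
  have : AntitoneOn (fun y => py ψ 0 y - 2 * y) (Icc 0 (η 0)) := by
    have hd : ∀ y, HasDerivAt (fun y => py ψ 0 y - 2 * y) (py (py ψ) 0 y - 2) y := by
      intro y
      have := (h.psi.sm_py.dy 0 y).sub ((hasDerivAt_id y).const_mul 2)
      exact this.congr_deriv (by simp)
    refine antitoneOn_of_deriv_nonpos (convex_Icc _ _)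
      (fun y _ => (hd y).continuousAt.continuousWithinAt)
      (fun y _ => (hd y).differentiableAt.differentiableWithinAt) ?_
    intro y hy
    rw [interior_Icc] at hy
    rw [(hd y).deriv]
    linarith [h.pyy_crest hy.1 hy.2]
  exact this ⟨h1, h2⟩ ⟨(h.eta_pos 0).le, le_rfl⟩ h2

/-- On the trough line `ψ_y - 2y` is nondecreasing. -/
lemma trough_slope (h : SW ε Λ ψ η) {y : ℝ} (h1 : 0 ≤ y) (h2 : y ≤ η Λ) :
    py ψ Λ y - 2 * y ≤ py ψ Λ (η Λ) - 2 * η Λ := by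
  have : MonotoneOn (fun y => py ψ Λ y - 2 * y) (Icc 0 (η Λ)) := by
    have hd : ∀ y, HasDerivAt (fun y => py ψ Λ y - 2 * y) (py (py ψ) Λ y - 2) y := by
      intro y
      have := (h.psi.sm_py.dy Λ y).sub ((hasDerivAt_id y).const_mul 2)
      exact this.congr_deriv (by simp)
    refine monotoneOn_of_deriv_nonneg (convex_Icc _ _)
      (fun y _ => (hd y).continuousAt.continuousWithinAt)
      (fun y _ => (hd y).differentiableAt.differentiableWithinAt) ?_
    intro y hy
    rw [interior_Icc] at hy
    rw [(hd y).deriv]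
    linarith [h.pyy_trough hy.1 hy.2]
  exact this ⟨h1, h2⟩ ⟨(h.eta_pos Λ).le, le_rfl⟩ h2

/-- Concavity on the crest line: tangent at the top. -/
lemma crest_tangent (h : SW ε Λ ψ η) {y : ℝ} (h1 : 0 ≤ y) (h2 : y ≤ η 0) :
    ψ 0 y - y ^ 2 ≤ 1 - η 0 ^ 2 + (py ψ 0 (η 0) - 2 * η 0) * (y - η 0) := by
  set q := py ψ 0 (η 0) - 2 * η 0 with hq
  have : MonotoneOn (fun y => ψ 0 y - y ^ 2 - q * y) (Icc 0 (η 0)) := by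
    have hd : ∀ y, HasDerivAt (fun y => ψ 0 y - y ^ 2 - q * y) (py ψ 0 y - 2 * y - q) y := by
      intro y
      have := ((h.psi.dy 0 y).sub ((hasDerivAt_id y).pow 2)).sub ((hasDerivAt_id y).const_mul q)
      exact this.congr_deriv (by simp)
    refine monotoneOn_of_deriv_nonneg (convex_Icc _ _)
      (fun y _ => (hd y).continuousAt.continuousWithinAt)
      (fun y _ => (hd y).differentiableAt.differentiableWithinAt) ?_
    intro y hy
    rw [interior_Icc] at hy
    rw [(hd y).deriv]
    linarith [h.crest_slope hy.1.le hy.2.le]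
  have := this ⟨h1, h2⟩ ⟨(h.eta_pos 0).le, le_rfl⟩ h2
  simp only [h.surf] at this
  linarith

end SW


lemma deriv_nonpos_of_top {g : ℝ → ℝ} {g' b : ℝ} (hb : 0 < b) (hg : HasDerivAt g g' b)
    (h : ∀ y, 0 ≤ y → y ≤ b → 0 ≤ g y) (h0 : g b = 0) : g' ≤ 0 := by
  have h3 := hg.hasDerivWithinAt (s := Iio b)
  rw [hasDerivWithinAt_iff_tendsto_slope' (by simp)] at h3
  refine le_of_tendsto h3 ?_
  have ev : ∀ᶠ t in nhdsWithin b (Iio b), 0 < t := nhdsWithin_le_nhds (isOpen_Ioi.mem_nhds hb)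
  filter_upwards [ev, self_mem_nhdsWithin] with t ht ht0
  have ht0' : t < b := ht0
  rw [slope_def_field, h0, sub_zero]
  exact div_nonpos_of_nonneg_of_nonpos (h t ht.le ht0'.le) (by linarith)

namespace SW
variable {ε Λ : ℝ} {ψ : ℝ → ℝ → ℝ} {η : ℝ → ℝ}

lemma crest_bern (h : SW ε Λ ψ η) : py ψ 0 (η 0) ^ 2 = 4 + 2 * ε * (1 - η 0) := by
  have := h.bern 0
  rw [h.px_crest] at this
  linarith

lemma trough_bern (h : SW ε Λ ψ η) : py ψ Λ (η Λ) ^ 2 = 4 + 2 * ε * (1 - η Λ) := by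
  have := h.bern Λ
  rw [h.px_trough] at this
  linarith

lemma crest_nonneg (h : SW ε Λ ψ η) : 0 ≤ py ψ 0 (η 0) := h.py_nonneg 0 (h.eta_pos 0).le le_rfl
lemma trough_nonneg (h : SW ε Λ ψ η) : 0 ≤ py ψ Λ (η Λ) := h.py_nonneg Λ (h.eta_pos Λ).le le_rfl

/-- `φ + A y ≥ 0`. -/
lemma low (h : SW ε Λ ψ η) {x y : ℝ} (h1 : 0 ≤ y) (h2 : y ≤ η x) :
    0 ≤ qd 1 (-1) (η 0 - 1 / η 0) ψ x y := by
  refine h.min_strip (by norm_num) ?_ h1 h2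
  intro x
  have h3 := h.eta_pos x
  have h4 := h.eta_le x
  have h5 := h.eta_pos 0
  have e : 1 + -1 * η x ^ 2 + (η 0 - 1 / η 0) * η x = (η 0 - η x) * (1 / η 0 + η x) := by
    field_simp; ring
  rw [e]
  have : 0 ≤ η 0 - η x := by linarith
  positivity

/-- `B y - φ ≥ 0`. -/
lemma upp (h : SW ε Λ ψ η) {x y : ℝ} (h1 : 0 ≤ y) (h2 : y ≤ η x) :
    0 ≤ qd (-1) 1 (1 / η Λ - η Λ) ψ x y := by
  refine h.min_strip (by norm_num) ?_ h1 h2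
  intro x
  have h3 := h.eta_pos x
  have h4 := h.le_eta x
  have h5 := h.eta_pos Λ
  have e : -1 + 1 * η x ^ 2 + (1 / η Λ - η Λ) * η x = (η x - η Λ) * (1 / η Λ + η x) := by
    field_simp; ring
  rw [e]
  have : 0 ≤ η x - η Λ := by linarith
  positivity

lemma trough_q (h : SW ε Λ ψ η) : η Λ + 1 / η Λ ≤ py ψ Λ (η Λ) := by
  have h5 := h.eta_pos Λ
  have h1 := deriv_nonpos_of_top h5 ((h.psi.qd (-1) 1 (1 / η Λ - η Λ)).dy Λ (η Λ))
    (fun y a b => h.upp a b) (by simp only [qd, h.surf]; field_simp; ring)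
  rw [py_qd h.psi] at h1
  linarith

lemma crest_q (h : SW ε Λ ψ η) : py ψ 0 (η 0) ≤ η 0 + 1 / η 0 := by
  have h5 := h.eta_pos 0
  have h1 := deriv_nonpos_of_top h5 ((h.psi.qd 1 (-1) (η 0 - 1 / η 0)).dy 0 (η 0))
    (fun y a b => h.low a b) (by simp only [qd, h.surf]; field_simp; ring)
  rw [py_qd h.psi] at h1
  linarith

lemma trough_sq (h : SW ε Λ ψ η) : (1 / η Λ - η Λ) ^ 2 ≤ 2 * ε * (1 - η Λ) := by
  have h5 := h.eta_pos Λ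
  have h1 := h.trough_q
  have h2 := h.trough_bern
  have h3 : (η Λ + 1 / η Λ) ^ 2 ≤ py ψ Λ (η Λ) ^ 2 := by gcongr
  have e : (1 / η Λ - η Λ) ^ 2 = (η Λ + 1 / η Λ) ^ 2 - 4 := by field_simp; ring
  linarith

lemma crest_sq (h : SW ε Λ ψ η) : 2 * ε * (1 - η 0) ≤ (1 / η 0 - η 0) ^ 2 := by
  have h5 := h.eta_pos 0
  have h1 := h.crest_q
  have h2 := h.crest_bern
  have h4 := h.crest_nonneg
  have h3 : py ψ 0 (η 0) ^ 2 ≤ (η 0 + 1 / η 0) ^ 2 := by gcongr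
  have e : (1 / η 0 - η 0) ^ 2 = (η 0 + 1 / η 0) ^ 2 - 4 := by field_simp; ring
  linarith

lemma trough_le_one (h : SW ε Λ ψ η) (hε : 0 < ε) : η Λ ≤ 1 := by
  have h1 := h.trough_sq
  by_contra hc
  push Not at hc
  nlinarith [sq_nonneg (1 / η Λ - η Λ)]

lemma trough_poly (h : SW ε Λ ψ η) (hε : 0 < ε) :
    (1 - η Λ) * (1 + η Λ) ^ 2 ≤ 2 * ε * η Λ ^ 2 := by
  have h1 := h.trough_sq
  have h2 := h.trough_le_one hε
  have h5 := h.eta_pos Λ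
  rcases h2.eq_or_lt with e | e
  · rw [e]; linarith
  have e1 : (1 / η Λ - η Λ) ^ 2 * η Λ ^ 2 = (1 - η Λ) * ((1 - η Λ) * (1 + η Λ) ^ 2) := by
    field_simp; ring
  have e2 : (1 / η Λ - η Λ) ^ 2 * η Λ ^ 2 ≤ 2 * ε * (1 - η Λ) * η Λ ^ 2 := by gcongr
  rw [e1] at e2
  have : 0 < 1 - η Λ := by linarith
  refine le_of_mul_le_mul_left ?_ this
  linarith

lemma trough_ge (h : SW ε Λ ψ η) (hε : 0 < ε) : 1 - ε / 2 ≤ η Λ := by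
  have h1 := h.trough_poly hε
  have h2 := h.trough_le_one hε
  have h5 := h.eta_pos Λ
  have h3 : 4 * η Λ ^ 2 ≤ (1 + η Λ) ^ 2 := by nlinarith
  have h4 : (1 - η Λ) * (4 * η Λ ^ 2) ≤ (1 - η Λ) * (1 + η Λ) ^ 2 :=
    mul_le_mul_of_nonneg_left h3 (by linarith)
  have h6 : η Λ ^ 2 * (4 * (1 - η Λ)) ≤ η Λ ^ 2 * (2 * ε) := by linarith
  have := le_of_mul_le_mul_left h6 (by positivity)
  linarith

lemma B_bd (h : SW ε Λ ψ η) (hε : 0 < ε) :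
    0 ≤ 1 / η Λ - η Λ ∧ 1 / η Λ - η Λ ≤ ε := by
  have h1 := h.trough_sq
  have h2 := h.trough_le_one hε
  have h3 := h.trough_ge hε
  have h5 := h.eta_pos Λ
  constructor
  · have : 1 ≤ 1 / η Λ := by rw [le_div_iff₀ h5]; linarith
    linarith
  · apply le_of_sq_le_sq _ hε.le
    nlinarith

lemma trough_q_le (h : SW ε Λ ψ η) (hε : 0 < ε) : py ψ Λ (η Λ) ≤ 2 + ε := by
  have h1 := h.trough_bern
  have h3 := h.trough_ge hε
  apply le_of_sq_le_sq _ (by linarith)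
  nlinarith

/-- Harmonicity of `φ + A y` below the trough level. -/
lemma harm (h : SW ε Λ ψ η) {α β δ : ℝ} (hαβ : α + β = 0) (x y : ℝ) (h1 : 0 < y)
    (h2 : y < η Λ) :
    px (px (qd α β δ ψ)) x y + py (py (qd α β δ ψ)) x y = 0 := by
  rw [lap_qd h.psi, h.lap x y h1 (h2.trans_le (h.le_eta x))]; linarith

lemma qd_bot (h : SW ε Λ ψ η) (α β δ x : ℝ) : qd α β δ ψ x 0 = 0 := by simp [qd, h.bot]

lemma crest_ne_one (h : SW ε Λ ψ η) (hε : 0 < ε) (hε1 : ε ≤ 1 / 100000) : η 0 ≠ 1 := by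
  intro hc
  have hE := h.trough_ge hε
  have hq : py ψ 0 (η 0) = 2 := by
    have := h.crest_bern
    have h2 := h.crest_nonneg
    rw [hc] at this h2 ⊢
    nlinarith
  have hpos : ∀ x y, 0 ≤ y → y < η Λ → 0 ≤ qd 1 (-1) 0 ψ x y := by
    intro x y h1 h2
    have := h.low h1 (h2.le.trans (h.le_eta x))
    rwa [hc, show (1 : ℝ) - 1 / 1 = 0 by norm_num] at this
  have hk : ∀ x, 0 ≤ py (qd 1 (-1) 0 ψ) x 0 := by
    intro x
    rw [py_qd h.psi]
    have := h.py_nonneg x le_rfl (h.eta_pos x).le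
    simpa using this
  have hd : ∀ X0 ρ, 0 < ρ → ρ < η Λ → _ := fun X0 ρ h1 h2 =>
    halfdisc (h.psi.qd 1 (-1) 0) (X0 := X0) h1 h2 (h.harm (by norm_num)) (h.qd_bot _ _ _) hpos
  have hz : ∀ X y, 0 < y → y < 1 / 2 → qd 1 (-1) 0 ψ X y = 0 → py (qd 1 (-1) 0 ψ) X 0 = 0 := by
    intro X y h1 h2 h3
    have := ((hd X (1 / 2) (by norm_num) (by linarith)).1 y h1 h2).2
    rw [h3] at this
    refine le_antisymm ?_ (hk X)
    by_contra hcon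
    push Not at hcon
    have : 0 < (1 / 2 : ℝ) ^ 2 * py (qd 1 (-1) 0 ψ) X 0 * y * (1 / 2 - y) := by
      have : 0 < 1 / 2 - y := by linarith
      positivity
    linarith
  have hz0 : py (qd 1 (-1) 0 ψ) 0 0 = 0 := by
    refine hz 0 (1 / 4) (by norm_num) (by norm_num) ?_
    refine le_antisymm ?_ (hpos _ _ (by norm_num) (by linarith))
    have := h.crest_tangent (y := 1 / 4) (by norm_num) (by rw [hc]; norm_num)
    rw [hq, hc] at this
    simp only [qd]
    linarith
  have hstep : ∀ X x, |x| ≤ 1 / 4 → py (qd 1 (-1) 0 ψ) X 0 = 0 →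
      py (qd 1 (-1) 0 ψ) (X + x) 0 = 0 := by
    intro X x hx h1
    refine hz _ (1 / 4) (by norm_num) (by norm_num) ?_
    refine (hd X (1 / 2) (by norm_num) (by linarith)).2 h1 x (1 / 4) (by norm_num) ?_
    rw [abs_le] at hx
    nlinarith
  have hn : ∀ n : ℕ, py (qd 1 (-1) 0 ψ) (n * (1 / 4)) 0 = 0 := by
    intro n
    induction n with
    | zero => simpa using hz0
    | succ n ih =>
      have := hstep _ (1 / 4) (by rw [abs_of_pos] <;> norm_num) ih
      push_cast
      convert this using 1
      ring
  have hL : py (qd 1 (-1) 0 ψ) Λ 0 = 0 := by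
    have hl := h.lam_pos
    have h1 := Nat.floor_le (show 0 ≤ 4 * Λ by linarith)
    have h2 := Nat.lt_floor_add_one (4 * Λ)
    have := hstep _ (Λ - (⌊4 * Λ⌋₊ : ℝ) * (1 / 4)) (by rw [abs_le]; constructor <;> linarith)
      (hn ⌊4 * Λ⌋₊)
    convert this using 1
    ring
  have hline : ∀ y, 0 < y → y < η Λ → qd 1 (-1) 0 ψ Λ y = 0 := by
    intro y h1 h2
    have := (hd Λ ((y + η Λ) / 2) (by linarith) (by linarith)).2 hL 0 y h1.le (by nlinarith)
    simpa using this
  have := eq_on_Icc_of_Ioo (g := fun y => qd 1 (-1) 0 ψ Λ y)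
    ((h.psi.qd 1 (-1) 0).cont.comp (Continuous.prodMk_right Λ)) (h.eta_pos Λ) hline
    (h.eta_pos Λ).le le_rfl
  simp only [qd, h.surf] at this
  have h7 := h.trough_lt_crest
  have h8 := h.eta_pos Λ
  nlinarith

lemma crest_gt_one (h : SW ε Λ ψ η) (hε : 0 < ε) (hε1 : ε ≤ 1 / 100000) : 1 < η 0 := by
  rcases lt_trichotomy (η 0) 1 with hc | hc | hc
  · exfalso
    have h1 := h.trough_poly hε
    have h2 := h.crest_sq
    have h3 := h.trough_lt_crest
    have h4 := h.eta_pos Λ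
    have h5 := h.eta_pos 0
    set c := η 0
    set e := η Λ
    have e1 : (1 / c - c) ^ 2 * c ^ 2 = (1 - c) * ((1 - c) * (1 + c) ^ 2) := by
      field_simp; ring
    have e2 : 2 * ε * (1 - c) * c ^ 2 ≤ (1 / c - c) ^ 2 * c ^ 2 := by gcongr
    rw [e1] at e2
    have hc1 : 0 < 1 - c := by linarith
    have e3 : 2 * ε * c ^ 2 ≤ (1 - c) * (1 + c) ^ 2 := by
      refine le_of_mul_le_mul_left ?_ hc1
      linarith
    have e4 : (1 - e) * (1 + e) ^ 2 * c ^ 2 ≤ 2 * ε * e ^ 2 * c ^ 2 := by gcongr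
    have e5 : 2 * ε * c ^ 2 * e ^ 2 ≤ (1 - c) * (1 + c) ^ 2 * e ^ 2 := by gcongr
    have e6 : ((1 + c) * e) ^ 2 < ((1 + e) * c) ^ 2 := by
      apply pow_lt_pow_left₀ _ (by positivity) (by norm_num)
      nlinarith
    have e7 : (1 - c) * ((1 + c) * e) ^ 2 < (1 - e) * ((1 + e) * c) ^ 2 := by
      have : (1 - c) * ((1 + c) * e) ^ 2 < (1 - c) * ((1 + e) * c) ^ 2 :=
        mul_lt_mul_of_pos_left e6 hc1
      have h8 : (1 - c) * ((1 + e) * c) ^ 2 ≤ (1 - e) * ((1 + e) * c) ^ 2 := by gcongr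
      linarith
    nlinarith
  · exact absurd hc (h.crest_ne_one hε hε1)
  · exact hc

lemma crest_q_ge (h : SW ε Λ ψ η) (hε : 0 < ε) (hε1 : ε ≤ 1 / 100000) :
    2 - ε * (η 0 - 1) ≤ py ψ 0 (η 0) := by
  have h1 := h.crest_bern
  have h2 := h.crest_nonneg
  have h3 := h.crest_gt_one hε hε1
  have h4 : 0 < ε * (η 0 - 1) := mul_pos hε (by linarith)
  by_contra hc
  push Not at hc
  nlinarith

lemma crest_ge (h : SW ε Λ ψ η) (hε : 0 < ε) (hε1 : ε ≤ 1 / 100000) : 11 / 10 ≤ η 0 := by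
  have h3 := h.crest_gt_one hε hε1
  have hq := h.crest_q_ge hε hε1
  have hE := h.trough_ge hε
  have h1 := ((halfdisc (ρ := 3 / 4) (h.psi.qd 1 (-1) (η 0 - 1 / η 0)) (X0 := 0) (H := η Λ)
    (by norm_num)
    (by linarith) (h.harm (by norm_num)) (h.qd_bot _ _ _)
    (fun x y a b => h.low a (b.le.trans (h.le_eta x)))).1 (1 / 4) (by norm_num) (by norm_num)).2
  rw [py_qd h.psi] at h1
  have hk := h.py_nonneg 0 le_rfl (h.eta_pos 0).le
  have ht := h.crest_tangent (y := 1 / 4) (by norm_num) (by linarith)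
  simp only [qd] at h1
  set κ := py ψ 0 0
  set q := py ψ 0 (η 0)
  set c := η 0
  have hc0 : 0 < c := by linarith
  by_contra hcon
  push Not at hcon
  -- combine
  have h4 : 9 / 80 * (c - 1 / c) ≤ (c + 1 / c - q) * (c - 1 / 4) := by
    have e : 1 - c ^ 2 + (c - 1 / c) * c = 0 := by field_simp; ring
    nlinarith
  have h5 : (c + 1 / c - q) * (c - 1 / 4) ≤ (c + 1 / c - 2 + ε * (c - 1)) * (c - 1 / 4) := by
    apply mul_le_mul_of_nonneg_right <;> linarith
  have h6 : 9 / 80 * (c - 1 / c) * c ≤ (c + 1 / c - 2 + ε * (c - 1)) * (c - 1 / 4) * c :=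
    mul_le_mul_of_nonneg_right (h4.trans h5) hc0.le
  have e1 : 9 / 80 * (c - 1 / c) * c = (c - 1) * (9 / 80 * (c + 1)) := by field_simp; ring
  have e2 : (c + 1 / c - 2 + ε * (c - 1)) * (c - 1 / 4) * c =
      (c - 1) * ((c - 1 + ε * c) * (c - 1 / 4)) := by field_simp; ring
  rw [e1, e2] at h6
  have h7 := le_of_mul_le_mul_left h6 (by linarith)
  have h8 : c - 1 + ε * c ≤ 11 / 100 := by nlinarith
  have h9 : (c - 1 + ε * c) * (c - 1 / 4) ≤ 11 / 100 * (c - 1 / 4) :=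
    mul_le_mul_of_nonneg_right h8 (by linarith)
  linarith

lemma crest_psi (h : SW ε Λ ψ η) (hε : 0 < ε) (hε1 : ε ≤ 1 / 100000) :
    361 / 400 - 100 * ε ≤ ψ 0 (19 / 20) := by
  have hE := h.trough_ge hε
  have hB := h.B_bd hε
  have h1 := ((halfdisc (ρ := 49 / 50) (h.psi.qd (-1) 1 (1 / η Λ - η Λ)) (X0 := 0) (H := η Λ)
    (by norm_num)
    (by linarith) (h.harm (by norm_num)) (h.qd_bot _ _ _)
    (fun x y a b => h.upp a (b.le.trans (h.le_eta x)))).1 (19 / 20) (by norm_num)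
      (by norm_num)).1
  rw [py_qd h.psi] at h1
  have hk := h.py_nonneg 0 le_rfl (h.eta_pos 0).le
  simp only [qd] at h1
  linarith

lemma crest_big (h : SW ε Λ ψ η) (hε : 0 < ε) (hε1 : ε ≤ 1 / 100000) : 13 / 5 ≤ η 0 := by
  have h1 := h.crest_ge hε hε1
  have h2 := h.crest_psi hε hε1
  have hq := h.crest_q_ge hε hε1
  have ht := h.crest_tangent (y := 19 / 20) (by norm_num) (by linarith)
  set q := py ψ 0 (η 0)
  set c := η 0
  by_contra hcon
  push Not at hcon
  have h5 : (2 * c - q) * (c - 19 / 20) ≤ (2 * c - 2 + ε * (c - 1)) * (c - 19 / 20) := by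
    apply mul_le_mul_of_nonneg_right <;> linarith
  have h6 : ε * (c - 19 / 20) ≤ 1 / 50000 := by nlinarith
  have h7 : (c - 1) * (ε * (c - 19 / 20)) ≤ (c - 1) * (1 / 50000) :=
    mul_le_mul_of_nonneg_left h6 (by linarith)
  nlinarith

end SW


lemma hasDerivAt_param_integral {u : ℝ → ℝ → ℝ} (hu : Sm u) (x : ℝ) :
    HasDerivAt (fun x => ∫ s in (0 : ℝ)..1, u x s) (∫ s in (0 : ℝ)..1, px u x s) x := by
  have hc := hu.cont
  have hc' := hu.sm_px.cont
  obtain ⟨M, hM⟩ := ((isCompact_Icc (a := x - 1) (b := x + 1)).prod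
    (isCompact_Icc (a := (0 : ℝ)) (b := 1))).exists_bound_of_continuousOn hc'.continuousOn
  have hs : Ioo (x - 1) (x + 1) ∈ nhds x := Ioo_mem_nhds (by linarith) (by linarith)
  refine (intervalIntegral.hasDerivAt_integral_of_dominated_loc_of_deriv_le (F := u)
    (F' := fun x s => px u x s) (bound := fun _ => M) hs ?_ ?_ ?_ ?_ ?_ ?_).2
  · filter_upwards with t
    exact (hc.comp (Continuous.prodMk_right t)).aestronglyMeasurable
  · exact (hc.comp (Continuous.prodMk_right x)).intervalIntegrable _ _
  · exact (hc'.comp (Continuous.prodMk_right x)).aestronglyMeasurable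
  · filter_upwards with s hs t ht
    rw [uIoc_of_le zero_le_one] at hs
    exact hM (t, s) ⟨⟨ht.1.le, ht.2.le⟩, ⟨hs.1.le, hs.2⟩⟩
  · exact intervalIntegrable_const
  · filter_upwards with s hs t ht
    exact hu.dx t s

/-- Flow force density. -/
def ffd (ψ : ℝ → ℝ → ℝ) (x y : ℝ) : ℝ := (py ψ x y ^ 2 - px ψ x y ^ 2) / 2 + 2 * ψ x y

lemma Sm.ffd {ψ : ℝ → ℝ → ℝ} (h : Sm ψ) : Sm (ffd ψ) := by
  have h0 : ContDiff ℝ (⊤ : ℕ∞) (fun p : ℝ × ℝ => ψ p.1 p.2) := h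
  have h1 : ContDiff ℝ (⊤ : ℕ∞) (fun p : ℝ × ℝ => px ψ p.1 p.2) := h.sm_px
  have h2 : ContDiff ℝ (⊤ : ℕ∞) (fun p : ℝ × ℝ => py ψ p.1 p.2) := h.sm_py
  exact (((h2.pow 2).sub (h1.pow 2)).div_const 2).add (contDiff_const.mul h0)

lemma px_ffd {ψ : ℝ → ℝ → ℝ} (h : Sm ψ) (x y : ℝ) : px (ffd ψ) x y =
    py ψ x y * py (px ψ) x y - px ψ x y * px (px ψ) x y + 2 * px ψ x y := by
  have h1 := ((((h.sm_py.dx x y).pow 2).sub ((h.sm_px.dx x y).pow 2)).div_const 2).add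
    ((h.dx x y).const_mul 2)
  have h2 : px (ffd ψ) x y = _ := h1.deriv
  rw [h2, h.comm]
  push_cast
  ring

namespace SW
variable {ε Λ : ℝ} {ψ : ℝ → ℝ → ℝ} {η : ℝ → ℝ}

lemma lap_cl (h : SW ε Λ ψ η) {x y : ℝ} (h1 : 0 ≤ y) (h2 : y ≤ η x) :
    px (px ψ) x y + py (py ψ) x y = 2 :=
  eq_on_Icc_of_Ioo (g := fun y => px (px ψ) x y + py (py ψ) x y)
    ((h.psi.sm_px.sm_px.cont.comp (Continuous.prodMk_right x)).add
      (h.psi.sm_py.sm_py.cont.comp (Continuous.prodMk_right x))) (h.eta_pos x)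
    (h.lap x) h1 h2

/-- The flow force. -/
def FF (ε : ℝ) (ψ : ℝ → ℝ → ℝ) (η : ℝ → ℝ) (x : ℝ) : ℝ :=
  (∫ s in (0 : ℝ)..1, η x * ffd ψ x (η x * s)) + ε * (η x - η x ^ 2 / 2)

lemma FF_deriv (h : SW ε Λ ψ η) (x : ℝ) : HasDerivAt (FF ε ψ η) 0 x := by
  set u : ℝ → ℝ → ℝ := fun x s => η x * ffd ψ x (η x * s) with hu
  have hG := h.psi.ffd
  have hus : Sm u := by
    have e1 : ContDiff ℝ (⊤ : ℕ∞) (fun p : ℝ × ℝ => η p.1) := h.eta_smooth.comp contDiff_fst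
    have e2 : ContDiff ℝ (⊤ : ℕ∞) (fun p : ℝ × ℝ => (p.1, η p.1 * p.2)) :=
      contDiff_fst.prodMk (e1.mul contDiff_snd)
    have e3 : ContDiff ℝ (⊤ : ℕ∞) (fun p : ℝ × ℝ => ffd ψ p.1 p.2) := hG
    exact e1.mul (e3.comp e2)
  have hη := h.eta_deriv x
  set e := η x with he
  set e' := deriv η x with he'
  have hpu : ∀ s, px u x s = e' * ffd ψ x (e * s) +
      e * (px (ffd ψ) x (e * s) + py (ffd ψ) x (e * s) * (e' * s)) := by
    intro s
    have h1 := hG.chain (hasDerivAt_id x) (hη.mul_const s)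
    have h2 := (hη.mul h1).deriv
    refine Eq.trans (Eq.trans ?_ h2) ?_
    · rfl
    · simp [he]
  have hV : ∀ s ∈ uIcc (0 : ℝ) 1, HasDerivAt
      (fun s => e' * s * ffd ψ x (e * s) + px ψ x (e * s) * py ψ x (e * s)) (px u x s) s := by
    intro s hs
    rw [uIcc_of_le zero_le_one] at hs
    have hb : HasDerivAt (fun s => e * s) e s := by
      simpa using (hasDerivAt_id s).const_mul e
    have hb' : HasDerivAt (fun s => e' * s) e' s := by
      simpa using (hasDerivAt_id s).const_mul e'
    have ha := hasDerivAt_const s x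
    have h1 := (hb'.mul (hG.chain ha hb)).add
      ((h.psi.sm_px.chain ha hb).mul (h.psi.sm_py.chain ha hb))
    refine h1.congr_deriv ?_
    have hep := h.eta_pos x
    have hl := h.lap_cl (x := x) (y := e * s) (mul_nonneg hep.le hs.1)
      (by rw [he]; nlinarith [hs.2])
    rw [hpu, px_ffd h.psi]
    have : py (py ψ) x (e * s) = 2 - px (px ψ) x (e * s) := by linarith
    rw [this]
    ring
  have hinn : (∫ s in (0 : ℝ)..1, px u x s) = - (ε * (1 - e) * e') := by
    rw [intervalIntegral.integral_eq_sub_of_hasDerivAt hV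
      ((hus.sm_px.cont.comp (Continuous.prodMk_right x)).intervalIntegrable _ _)]
    have hk := h.kin x
    have hb := h.bern x
    rw [← he] at hk hb
    have hs := h.surf x
    rw [← he] at hs
    have hk' : px ψ x e = - (py ψ x e * e') := by linarith
    simp only [mul_one, mul_zero, h.px_bot, ffd, hs]
    have : py ψ x e ^ 2 = 4 + 2 * ε * (1 - e) - px ψ x e ^ 2 := by linarith
    have h3 : px ψ x e * py ψ x e = - e' * py ψ x e ^ 2 := by rw [hk']; ring
    rw [h3, this]
    ring
  have h1 := hasDerivAt_param_integral hus x
  rw [hinn] at h1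
  have h2 := (hη.sub ((hη.pow 2).div_const 2)).const_mul ε
  refine (h1.add h2).congr_deriv ?_
  push_cast
  rw [← he]
  ring

lemma FF_eq (h : SW ε Λ ψ η) (x : ℝ) :
    FF ε ψ η x = (∫ y in (0 : ℝ)..η x, ffd ψ x y) + ε * (η x - η x ^ 2 / 2) := by
  unfold FF
  rw [intervalIntegral.integral_const_mul, intervalIntegral.mul_integral_comp_mul_left]
  simp

lemma FF_const (h : SW ε Λ ψ η) : FF ε ψ η 0 = FF ε ψ η Λ :=
  is_const_of_deriv_eq_zero (fun x => (h.FF_deriv x).differentiableAt)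
    (fun x => (h.FF_deriv x).deriv) 0 Λ

lemma psi_mono (h : SW ε Λ ψ η) (x : ℝ) : MonotoneOn (fun y => ψ x y) (Icc 0 (η x)) := by
  refine monotoneOn_of_deriv_nonneg (convex_Icc _ _)
    (fun y _ => (h.psi.dy x y).continuousAt.continuousWithinAt)
    (fun y _ => (h.psi.dy x y).differentiableAt.differentiableWithinAt) ?_
  intro y hy
  rw [interior_Icc] at hy
  exact h.py_nonneg x hy.1.le hy.2.le

lemma ffd_int (h : SW ε Λ ψ η) (x a b : ℝ) :
    IntervalIntegrable (fun y => ffd ψ x y) MeasureTheory.volume a b :=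
  (h.psi.ffd.cont.comp (Continuous.prodMk_right x)).intervalIntegrable _ _

lemma FF_crest (h : SW ε Λ ψ η) (hε : 0 < ε) (hε1 : ε ≤ 1 / 100000) :
    137 / 100 ≤ FF ε ψ η 0 := by
  rw [h.FF_eq]
  have hc := h.crest_big hε hε1
  have hp := h.crest_psi hε hε1
  have hm := h.psi_mono 0
  have hb := h.crest_bern
  set c := η 0
  have hsplit := intervalIntegral.integral_add_adjacent_intervals (h.ffd_int 0 0 (19 / 20))
    (h.ffd_int 0 (19 / 20) c)
  have hpos : ∀ y, ffd ψ 0 y = py ψ 0 y ^ 2 / 2 + 2 * ψ 0 y := by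
    intro y; simp [ffd, h.px_crest]
  have i1 : 0 ≤ ∫ y in (0 : ℝ)..19 / 20, ffd ψ 0 y := by
    refine intervalIntegral.integral_nonneg (by norm_num) ?_
    intro y hy
    rw [hpos]
    have : ψ 0 0 ≤ ψ 0 y := hm ⟨le_rfl, by linarith⟩ ⟨hy.1, by linarith [hy.2]⟩ hy.1
    rw [h.bot] at this
    positivity
  have i2 : ∫ _y in (19 / 20 : ℝ)..c, (9 / 5 : ℝ) ≤ ∫ y in (19 / 20 : ℝ)..c, ffd ψ 0 y := by
    refine intervalIntegral.integral_mono_on (by linarith) intervalIntegrable_const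
      (h.ffd_int _ _ _) ?_
    intro y hy
    rw [hpos]
    have : ψ 0 (19 / 20) ≤ ψ 0 y :=
      hm ⟨by norm_num, by linarith⟩ ⟨by linarith [hy.1], hy.2⟩ hy.1
    nlinarith [sq_nonneg (py ψ 0 y)]
  rw [intervalIntegral.integral_const, smul_eq_mul] at i2
  have h3 : ε * (c - 1) ≤ 2 := by nlinarith [sq_nonneg (py ψ 0 c)]
  have h4 : ε * (c - 1) * (c - 1) ≤ 2 * (c - 1) :=
    mul_le_mul_of_nonneg_right h3 (by linarith)
  nlinarith

lemma FF_trough (h : SW ε Λ ψ η) (hε : 0 < ε) (hε1 : ε ≤ 1 / 100000) :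
    FF ε ψ η Λ ≤ 136 / 100 := by
  rw [h.FF_eq]
  have he0 := h.eta_pos Λ
  have he1 := h.trough_le_one hε
  have he2 := h.trough_ge hε
  have hB := h.B_bd hε
  have hq := h.trough_q_le hε
  have i1 : ∫ y in (0 : ℝ)..η Λ, ffd ψ Λ y ≤ ∫ y in (0 : ℝ)..η Λ, (4 * y ^ 2 + 7 * ε) := by
    refine intervalIntegral.integral_mono_on he0.le (h.ffd_int _ _ _)
      (Continuous.intervalIntegrable (by fun_prop) _ _) ?_
    intro y hy
    have h1 := h.trough_slope hy.1 hy.2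
    have h2 := h.py_nonneg Λ hy.1 hy.2
    have h3 := h.upp hy.1 hy.2
    have h4 : py ψ Λ y ≤ 2 * y + 2 * ε := by linarith
    have h5 : py ψ Λ y ^ 2 ≤ (2 * y + 2 * ε) ^ 2 := by gcongr
    have hy1 : y ≤ 1 := hy.2.trans he1
    simp only [qd] at h3
    simp only [ffd, h.px_trough]
    have h6 : (1 / η Λ - η Λ) * y ≤ ε * 1 := by
      have := hy.1
      gcongr
      exact hB.2
    nlinarith [hy.1]
  have i2 : ∫ y in (0 : ℝ)..η Λ, (4 * y ^ 2 + 7 * ε) = 4 / 3 * η Λ ^ 3 + 7 * ε * η Λ := by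
    rw [intervalIntegral.integral_add (Continuous.intervalIntegrable (by fun_prop) _ _)
      (Continuous.intervalIntegrable (by fun_prop) _ _)]
    rw [intervalIntegral.integral_const_mul, integral_pow, intervalIntegral.integral_const]
    simp; ring
  rw [i2] at i1
  have h7 : η Λ ^ 3 ≤ 1 := pow_le_one₀ he0.le he1
  nlinarith

lemma false_of_small (h : SW ε Λ ψ η) (hε : 0 < ε) (hε1 : ε ≤ 1 / 100000) : False := by
  have h1 := h.FF_crest hε hε1
  have h2 := h.FF_trough hε hε1
  rw [h.FF_const] at h1
  linarith

end SW

/-! ### Scaling -/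

lemma px_scale {ψ : ℝ → ℝ → ℝ} (h : Sm ψ) (d : ℝ) :
    px (fun x y => ψ (d * x) (d * y)) = fun x y => d * px ψ (d * x) (d * y) := by
  ext x y
  have h1 : HasDerivAt (fun t => d * t) d x := by simpa using (hasDerivAt_id x).const_mul d
  have h2 := (h.chain h1 (hasDerivAt_const x (d * y))).deriv
  refine Eq.trans h2 ?_
  ring

lemma py_scale {ψ : ℝ → ℝ → ℝ} (h : Sm ψ) (d : ℝ) :
    py (fun x y => ψ (d * x) (d * y)) = fun x y => d * py ψ (d * x) (d * y) := by
  ext x y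
  have h1 : HasDerivAt (fun t => d * t) d y := by simpa using (hasDerivAt_id y).const_mul d
  have h2 := (h.chain (hasDerivAt_const y (d * x)) h1).deriv
  refine Eq.trans h2 ?_
  ring

lemma pxx_scale {ψ : ℝ → ℝ → ℝ} (h : Sm ψ) (d x y : ℝ) :
    px (px (fun x y => ψ (d * x) (d * y))) x y = d ^ 2 * px (px ψ) (d * x) (d * y) := by
  rw [px_scale h]
  have h1 : HasDerivAt (fun t => d * t) d x := by simpa using (hasDerivAt_id x).const_mul d
  have h2 := ((h.sm_px.chain h1 (hasDerivAt_const x (d * y))).const_mul d).deriv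
  refine Eq.trans h2 ?_
  ring

lemma pyy_scale {ψ : ℝ → ℝ → ℝ} (h : Sm ψ) (d x y : ℝ) :
    py (py (fun x y => ψ (d * x) (d * y))) x y = d ^ 2 * py (py ψ) (d * x) (d * y) := by
  rw [py_scale h]
  have h1 : HasDerivAt (fun t => d * t) d y := by simpa using (hasDerivAt_id y).const_mul d
  have h2 := ((h.sm_py.chain (hasDerivAt_const y (d * x)) h1).const_mul d).deriv
  refine Eq.trans h2 ?_
  ring

lemma scaled {γ r Λ d : ℝ} {ψ : ℝ → ℝ → ℝ} {η : ℝ → ℝ} (h : StokesWave γ ψ η r Λ)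
    (hu : Unidirectional ψ η) (hd : 0 < d) (hγ : γ * d ^ 2 = 2) (hr : r = γ + d) :
    SW (d ^ 3) (Λ / d) (fun x y => ψ (d * x) (d * y)) (fun x => η (d * x) / d) := by
  have hS : Sm ψ := h.sol.psi_smooth
  have hcan : ∀ x, d * (η (d * x) / d) = η (d * x) := fun x => by field_simp
  have hlt : ∀ {x y : ℝ}, y < η (d * x) / d → d * y < η (d * x) := by
    intro x y h1
    rw [← hcan x]
    exact mul_lt_mul_of_pos_left h1 hd
  have hper : ∀ x, d * (x + 2 * (Λ / d)) = d * x + 2 * Λ := fun x => by field_simp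
  refine ⟨?_, ?_, ?_, ?_, ?_, ?_, ?_, ?_, ?_, ?_, ?_, ?_, ?_, ?_⟩
  · exact (h.sol.eta_smooth.comp (contDiff_const.mul contDiff_id)).div_const d
  · exact fun x => div_pos (h.sol.eta_pos _) hd
  · have h1 : ContDiff ℝ (⊤ : ℕ∞) (fun p : ℝ × ℝ => (d * p.1, d * p.2)) :=
      (contDiff_const.mul contDiff_fst).prodMk (contDiff_const.mul contDiff_snd)
    exact h.sol.psi_smooth.comp h1
  · intro x y h1 h2
    rw [pxx_scale hS, pyy_scale hS]
    have := h.sol.laplace (d * x) (d * y) (mul_pos hd h1) (hlt h2)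
    have h3 : px (px ψ) (d * x) (d * y) + py (py ψ) (d * x) (d * y) = γ := this
    rw [← mul_add, h3]
    linarith
  · intro x
    rw [px_scale hS, py_scale hS]
    simp only [hcan]
    have := h.sol.bernoulli (d * x)
    have e : px ψ (d * x) (η (d * x)) ^ 2 + py ψ (d * x) (η (d * x)) ^ 2 =
        2 * (γ + d - η (d * x)) := by linarith
    rw [mul_pow, mul_pow, ← mul_add, e]
    have e2 : d ^ 2 * (2 * (γ + d - η (d * x))) =
        2 * (γ * d ^ 2) + 2 * d ^ 3 - 2 * d ^ 2 * η (d * x) := by ring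
    rw [e2, hγ]
    field_simp
    ring
  · intro x
    simp only [hcan]
    exact h.sol.surface_val _
  · intro x
    simp only [mul_zero]
    exact h.sol.bottom_val _
  · exact div_pos h.lam_pos hd
  · intro x
    simp only [hper, h.eta_periodic]
  · intro x
    simp only [mul_neg, h.eta_even]
  · intro x y
    simp only [hper, h.psi_periodic]
  · intro x y
    simp only [mul_neg, h.psi_even]
  · intro a ha b hb hab
    have hm : ∀ t ∈ Icc 0 (Λ / d), d * t ∈ Icc 0 Λ := by
      intro t ht
      refine ⟨mul_nonneg hd.le ht.1, ?_⟩
      have := (le_div_iff₀ hd).1 ht.2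
      linarith
    have := h.eta_anti (hm a ha) (hm b hb) (mul_lt_mul_of_pos_left hab hd)
    exact div_lt_div_of_pos_right this hd
  · intro x y h1 h2
    rw [py_scale hS]
    exact mul_pos hd (hu _ _ (mul_pos hd h1) (hlt h2))

/-- Theorem 4.1 (Stokes case): for large `γ` there is no unidirectional Stokes wave with
Bernoulli constant `r = R(0) = γ + √(2/γ)`. -/
theorem no_stokes_with_maximal_bernoulli :
    ∃ γ₀ > (0 : ℝ), ∀ γ > γ₀,
      ∀ (ψ : ℝ → ℝ → ℝ) (η : ℝ → ℝ) (r Λ : ℝ),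
        StokesWave γ ψ η r Λ → Unidirectional ψ η →
        r ≠ γ + Real.sqrt (2 / γ) := by
  refine ⟨2 * 100000 ^ 2, by norm_num, ?_⟩
  intro γ hγ ψ η r Λ h hu hr
  have hγ0 : 0 < γ := lt_trans (by norm_num) hγ
  have hd : 0 < Real.sqrt (2 / γ) := Real.sqrt_pos.2 (by positivity)
  have hsq : Real.sqrt (2 / γ) ^ 2 = 2 / γ := Real.sq_sqrt (by positivity)
  have hle : Real.sqrt (2 / γ) ≤ 1 / 100000 := by
    rw [Real.sqrt_le_left (by norm_num), div_le_iff₀ hγ0]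
    linarith
  refine (scaled h hu hd (by rw [hsq]; field_simp) hr).false_of_small (by positivity) ?_
  have h1 : Real.sqrt (2 / γ) ^ 3 ≤ (1 / 100000) ^ 3 := by gcongr
  refine h1.trans (by norm_num)
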